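/- Let P_n denote the path graph on n vertices. If n is even, then 2⌊n/16⌋ + 1 ≤ c^A_g(P_n) ≤ 4⌈n/16⌉ + 5 and 2⌊n/16⌋ − 5 ≤ c^I_g(P_n) ≤ 4⌈n/16⌉ − 1. If n is odd, then 2⌊n/16⌋ − 4 ≤ c^A_g(P_n) ≤ 4⌈n/16⌉ and 2⌊n/16⌋ ≤ c^I_g(P_n) ≤ 4⌈n/16⌉ + 4. -/

import Mathlib

open SimpleGraph

/-- The balance score of a state `(S0, S1)` in a graph `G`: the number of edges of `G` with
one endpoint in `S0` and the other in `S1`, minus the number of edges with both endpoints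
in `S0` or both endpoints in `S1`. -/
noncomputable def bscore {V : Type*} (G : SimpleGraph V) (S0 S1 : Set V) : ℤ :=
  ({e ∈ G.edgeSet | ∃ u ∈ S0, ∃ v ∈ S1, e = s(u, v)}.ncard : ℤ) -
  ({e ∈ G.edgeSet | (∃ u ∈ S0, ∃ v ∈ S0, e = s(u, v)) ∨
      (∃ u ∈ S1, ∃ v ∈ S1, e = s(u, v))}.ncard : ℤ)

/-- The value of the balance game computed by backward induction, with `k` moves remaining.
`t = true` means it is Admirable's (the minimizer's) turn, `t = false` means it is
Impish's (the maximizer's) turn.  `S0` is the set of vertices selected by Admirable so far,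
`S1` the set selected by Impish. -/
noncomputable def gameVal {V : Type*} [Fintype V] (G : SimpleGraph V) :
    ℕ → Bool → Finset V → Finset V → ℤ
  | 0, _, S0, S1 => bscore G ↑S0 ↑S1
  | (k + 1), t, S0, S1 =>
    letI := Classical.decEq V
    if h : (Finset.univ \ (S0 ∪ S1)).Nonempty then
      if t then (Finset.univ \ (S0 ∪ S1)).inf' h fun v => gameVal G k false (insert v S0) S1
      else (Finset.univ \ (S0 ∪ S1)).sup' h fun v => gameVal G k true S0 (insert v S1)
    else bscore G ↑S0 ↑S1

/-- The (A)-start game balance number `b^A_g(G)`. -/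
noncomputable def balA {V : Type*} [Fintype V] (G : SimpleGraph V) : ℤ :=
  gameVal G (Fintype.card V) true ∅ ∅

/-- The (I)-start game balance number `b^I_g(G)`. -/
noncomputable def balI {V : Type*} [Fintype V] (G : SimpleGraph V) : ℤ :=
  gameVal G (Fintype.card V) false ∅ ∅

/-- The value of the cordiality game computed by backward induction (final score is
`|bscore|`), with `k` moves remaining; `t = true` means it is Admirable's turn. -/
noncomputable def cordVal {V : Type*} [Fintype V] (G : SimpleGraph V) :
    ℕ → Bool → Finset V → Finset V → ℤ
  | 0, _, S0, S1 => |bscore G ↑S0 ↑S1|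
  | (k + 1), t, S0, S1 =>
    letI := Classical.decEq V
    if h : (Finset.univ \ (S0 ∪ S1)).Nonempty then
      if t then (Finset.univ \ (S0 ∪ S1)).inf' h fun v => cordVal G k false (insert v S0) S1
      else (Finset.univ \ (S0 ∪ S1)).sup' h fun v => cordVal G k true S0 (insert v S1)
    else |bscore G ↑S0 ↑S1|

/-- The (A)-start game cordiality number `c^A_g(G)`. -/
noncomputable def cordA {V : Type*} [Fintype V] (G : SimpleGraph V) : ℤ :=
  cordVal G (Fintype.card V) true ∅ ∅

/-- The (I)-start game cordiality number `c^I_g(G)`. -/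
noncomputable def cordI {V : Type*} [Fintype V] (G : SimpleGraph V) : ℤ :=
  cordVal G (Fintype.card V) false ∅ ∅

/-- A position of the cordiality game on a disjoint union of paths falls apart into segments: a
maximal run of `k` unselected vertices together with what bounds it on either side.  Sides are
coded by `0` (no neighbour), `1` (selected by the responder) and `3` (selected by the opponent),
and the segment by `8 * k + l + r`; this determines `k` and the unordered pair of sides. -/
def segWeight (c : ℕ) : ℕ :=
  match c % 8 with
  | 2 => 0
  | 6 => 0
  | 4 => 2
  | _ => 1

/-- The larger of the two sides of a segment. -/
def sideHi (c : ℕ) : ℕ :=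
  match c % 8 with
  | 0 => 0
  | 1 => 1
  | 2 => 1
  | _ => 3

/-- The smaller of the two sides of a segment. -/
def sideLo (c : ℕ) : ℕ := c % 8 - sideHi c

/-- The left part of a segment after a player `σ` selects its unselected vertex number `p`. -/
def cutLeft (σ c p : ℕ) : ℕ := 8 * p + (sideLo c + σ)

/-- The right part of a segment after a player `σ` selects its unselected vertex number `p`. -/
def cutRight (σ c p : ℕ) : ℕ := 8 * (c / 8 - 1 - p) + (σ + sideHi c)

/-- A group of segments, bounds for its final weight, and the replies of the responder that
keep these bounds, packed in base `256`. -/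
structure Entry where
  segs : List ℕ
  lo : ℕ
  hi : ℕ
  replies : ℕ

/-- A search tree of entries, keyed by `groupHash`. -/
inductive Table where
  | leaf : Table
  | node : Table → ℕ → List Entry → Table → Table

def groupHash : List ℕ → ℕ
  | [] => 0
  | c :: cs => c ^ 5 + groupHash cs

def Table.find (h : ℕ) : Table → List Entry
  | .leaf => []
  | .node l k es r =>
    bif Nat.beq h k then es else bif Nat.ble h k then l.find h else r.find h

/-- Remove one occurrence of a segment from a list. -/
def removeOne (c : ℕ) : List ℕ → Option (List ℕ)
  | [] => none
  | d :: ds => bif Nat.beq c d then some ds else (removeOne c ds).map (d :: ·)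

def isRearrangement : List ℕ → List ℕ → Bool
  | [], [] => true
  | [], _ :: _ => false
  | c :: cs, ds =>
    match removeOne c ds with
    | none => false
    | some ds' => isRearrangement cs ds'

/-- All ways to take one segment out of a list. -/
def picks : List ℕ → List (ℕ × List ℕ)
  | [] => []
  | c :: cs => (c, cs) :: (picks cs).map fun x => (x.1, c :: x.2)

/-- Test whether a list of segments splits into groups from the table whose bounds, added to
`x` and `y`, stay between `lo` and `hi`. -/
def splits (T : Table) (lo hi : ℕ) : ℕ → List ℕ → ℕ → ℕ → Bool
  | _, [], x, y => Nat.ble lo x && Nat.ble y hi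
  | 0, _ :: _, _, _ => false
  | n + 1, c :: cs, x, y =>
    ((T.find (groupHash (c :: cs))).any fun e =>
      Nat.ble lo (x + e.lo) && Nat.ble (y + e.hi) hi && isRearrangement e.segs (c :: cs)) ||
    ((T.find (groupHash [c])).any fun e =>
      isRearrangement e.segs [c] && splits T lo hi n cs (x + e.lo) (y + e.hi)) ||
    ((picks cs).any fun d => (T.find (groupHash [c, d.1])).any fun e =>
      isRearrangement e.segs [c, d.1] && splits T lo hi n d.2 (x + e.lo) (y + e.hi))

/-- `splits` preceded by evaluating the segments without unselected vertices. -/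
def splitsStrip (T : Table) (lo hi : ℕ) : List ℕ → List ℕ → ℕ → Bool
  | [], acc, x => splits T lo hi 8 acc x x
  | c :: cs, acc, x =>
    bif Nat.blt c 8 then splitsStrip T lo hi cs acc (x + segWeight c)
    else splitsStrip T lo hi cs (c :: acc) x

/-- Take the segment number `j` out of a list. -/
def takeOut : ℕ → List ℕ → Option (ℕ × List ℕ)
  | _, [] => none
  | 0, c :: cs => some (c, cs)
  | j + 1, c :: cs => (takeOut j cs).map fun x => (x.1, c :: x.2)

/-- Test the reply to select vertex `q` of segment `j`, where `h = 16 * j + q`. -/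
def replyOK (T : Table) (lo hi : ℕ) (L : List ℕ) (h : ℕ) : Bool :=
  match takeOut (h / 16) L with
  | none => false
  | some x =>
    Nat.blt (h % 16) (x.1 / 8) &&
      splitsStrip T lo hi (cutLeft 1 x.1 (h % 16) :: cutRight 1 x.1 (h % 16) :: x.2) [] 0

def positionsOK (T : Table) (lo hi : ℕ) (rest : List ℕ) (c : ℕ) : ℕ → ℕ → Bool
  | 0, _ => true
  | p + 1, h =>
    replyOK T lo hi (cutLeft 3 c p :: cutRight 3 c p :: rest) (h % 256) &&
      positionsOK T lo hi rest c p (h / 256)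

def segmentsOK (T : Table) (lo hi : ℕ) : List ℕ → List ℕ → ℕ → Bool
  | _, [], _ => true
  | pre, c :: cs, h =>
    positionsOK T lo hi (pre ++ cs) c (c / 8) h &&
      segmentsOK T lo hi (c :: pre) cs (h / 256 ^ (c / 8))

/-- Test that the replies stored in an entry answer every move of the opponent. -/
def entryOK (T : Table) (e : Entry) : Bool :=
  (e.segs.any fun c => Nat.blt 7 c) && segmentsOK T e.lo e.hi [] e.segs e.replies

def Table.all (f : Entry → Bool) : Table → Bool
  | .leaf => true
  | .node l _ es r => l.all f && es.all f && r.all f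

/-- All entries of a table. -/
def Table.entries : Table → List Entry
  | .leaf => []
  | .node l _ es r => l.entries ++ es ++ r.entries

theorem Table.mem_entries_of_mem_find {h : ℕ} {e : Entry} :
    ∀ {T : Table}, e ∈ T.find h → e ∈ T.entries
  | .leaf, he => by simp [Table.find] at he
  | .node l k es r, he => by
    simp only [Table.find, Bool.cond_eq_ite] at he
    simp only [Table.entries, List.mem_append]
    split_ifs at he
    · exact .inl (.inr he)
    · exact .inl (.inl (mem_entries_of_mem_find he))
    · exact .inr (mem_entries_of_mem_find he)

theorem Table.apply_of_all {f : Entry → Bool} {e : Entry} :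
    ∀ {T : Table}, T.all f = true → e ∈ T.entries → f e = true
  | .leaf, _, he => by simp [Table.entries] at he
  | .node l k es r, hT, he => by
    simp only [Table.all, Bool.and_eq_true, List.all_eq_true] at hT
    simp only [Table.entries, List.mem_append] at he
    obtain (he | he) | he := he
    · exact apply_of_all hT.1.1 he
    · exact hT.1.2 e he
    · exact apply_of_all hT.2 he

/-- `SegMove σ M N`: a player `σ` selects a vertex of one of the segments in `M`, which
leaves the segments in `N`. -/
def SegMove (σ : ℕ) (M N : Multiset ℕ) : Prop :=
  ∃ c p M', p < c / 8 ∧ M = c ::ₘ M' ∧ N = cutLeft σ c p ::ₘ cutRight σ c p ::ₘ M'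

theorem SegMove.add_left {σ : ℕ} {M N : Multiset ℕ} (K : Multiset ℕ) (h : SegMove σ M N) :
    SegMove σ (K + M) (K + N) := by
  obtain ⟨c, p, M', hp, rfl, rfl⟩ := h
  exact ⟨c, p, K + M', hp, by simp, by simp⟩

/-- `Good T M a b`: the position `M` decomposes into finished segments and groups from `T`, and
`a` and `b` are the sums of the lower and of the upper bounds for the parts. -/
inductive Good (T : Table) : Multiset ℕ → ℕ → ℕ → Prop
  | zero : Good T 0 0 0
  | finished {c : ℕ} {M : Multiset ℕ} {a b : ℕ} : c < 8 → Good T M a b →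
      Good T (c ::ₘ M) (a + segWeight c) (b + segWeight c)
  | entry {e : Entry} {M : Multiset ℕ} {a b : ℕ} : e ∈ T.entries → Good T M a b →
      Good T (↑e.segs + M) (a + e.lo) (b + e.hi)

theorem Good.add {T : Table} {M N : Multiset ℕ} {a b c d : ℕ} (hM : Good T M a b)
    (hN : Good T N c d) : Good T (M + N) (a + c) (b + d) := by
  induction hM with
  | zero => simpa using hN
  | finished h _ ih =>
    rw [Multiset.cons_add, add_right_comm, add_right_comm (_ : ℕ) _ d]
    exact .finished h ih
  | entry h _ ih =>
    rw [add_assoc, add_right_comm, add_right_comm (_ : ℕ) _ d]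
    exact .entry h ih

theorem Good.of_entry {T : Table} {e : Entry} (he : e ∈ T.entries) :
    Good T ↑e.segs e.lo e.hi := by
  simpa using Good.entry he .zero

theorem perm_of_removeOne {c : ℕ} :
    ∀ {L L' : List ℕ}, removeOne c L = some L' → L.Perm (c :: L')
  | [], _, h => by simp [removeOne] at h
  | d :: ds, L', h => by
    simp only [removeOne, Bool.cond_eq_ite, Nat.beq_eq] at h
    split_ifs at h with hc
    · simp only [Option.some.injEq] at h
      rw [hc, h]
    · obtain ⟨L, hL, rfl⟩ := Option.map_eq_some_iff.1 h
      exact ((perm_of_removeOne hL).cons d).trans (.swap c d L)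

theorem perm_of_isRearrangement :
    ∀ {L L' : List ℕ}, isRearrangement L L' = true → L.Perm L'
  | [], [], _ => .nil
  | [], _ :: _, h => by simp [isRearrangement] at h
  | c :: cs, ds, h => by
    unfold isRearrangement at h
    split at h
    · simp at h
    · next hr => exact ((perm_of_isRearrangement h).cons c).trans (perm_of_removeOne hr).symm

theorem perm_of_mem_picks {x : ℕ × List ℕ} :
    ∀ {L : List ℕ}, x ∈ picks L → L.Perm (x.1 :: x.2)
  | [], h => by simp [picks] at h
  | c :: cs, h => by
    simp only [picks, List.mem_cons, List.mem_map] at h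
    obtain rfl | ⟨y, hy, rfl⟩ := h
    · exact .refl _
    · exact ((perm_of_mem_picks hy).cons c).trans (.swap y.1 c y.2)

theorem perm_of_takeOut {x : ℕ × List ℕ} :
    ∀ {j : ℕ} {L : List ℕ}, takeOut j L = some x → L.Perm (x.1 :: x.2)
  | _, [], h => by simp [takeOut] at h
  | 0, c :: cs, h => by
    simp only [takeOut, Option.some.injEq] at h
    rw [← h]
  | j + 1, c :: cs, h => by
    simp only [takeOut] at h
    obtain ⟨y, hy, rfl⟩ := Option.map_eq_some_iff.1 h
    exact ((perm_of_takeOut hy).cons c).trans (.swap y.1 c y.2)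

theorem good_of_splits {T : Table} {lo hi : ℕ} :
    ∀ {n : ℕ} {L : List ℕ} {x y : ℕ}, splits T lo hi n L x y = true →
      ∃ a b, Good T ↑L a b ∧ lo ≤ x + a ∧ y + b ≤ hi
  | _, [], x, y, h => by
    simp only [splits, Bool.and_eq_true, Nat.ble_eq] at h
    exact ⟨0, 0, .zero, h⟩
  | 0, _ :: _, _, _, h => by simp [splits] at h
  | n + 1, c :: cs, x, y, h => by
    simp only [splits, Bool.or_eq_true, List.any_eq_true, Bool.and_eq_true, Nat.ble_eq] at h
    obtain (⟨e, he, h, hr⟩ | ⟨e, he, hr, h⟩) | ⟨d, hd, e, he, hr, h⟩ := h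
    · refine ⟨e.lo, e.hi, ?_, h⟩
      rw [← Multiset.coe_eq_coe.2 (perm_of_isRearrangement hr)]
      exact .of_entry (Table.mem_entries_of_mem_find he)
    · obtain ⟨a, b, hg, hl, hh⟩ := good_of_splits h
      refine ⟨a + e.lo, b + e.hi, ?_, by omega, by omega⟩
      have := Good.entry (Table.mem_entries_of_mem_find he) hg
      rwa [Multiset.coe_eq_coe.2 (perm_of_isRearrangement hr)] at this
    · obtain ⟨a, b, hg, hl, hh⟩ := good_of_splits h
      refine ⟨a + e.lo, b + e.hi, ?_, by omega, by omega⟩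
      have := Good.entry (Table.mem_entries_of_mem_find he) hg
      rwa [Multiset.coe_eq_coe.2 (perm_of_isRearrangement hr), Multiset.coe_add,
        List.cons_append, List.cons_append, List.nil_append,
        ← Multiset.coe_eq_coe.2 ((perm_of_mem_picks hd).cons c)] at this

theorem good_of_splitsStrip {T : Table} {lo hi : ℕ} :
    ∀ {L acc : List ℕ} {x : ℕ}, splitsStrip T lo hi L acc x = true →
      ∃ a b, Good T (↑L + ↑acc) a b ∧ lo ≤ x + a ∧ x + b ≤ hi
  | [], acc, x, h => by simpa using good_of_splits h
  | c :: cs, acc, x, h => by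
    simp only [splitsStrip, Bool.cond_eq_ite, Nat.blt_eq] at h
    split_ifs at h with hc
    · obtain ⟨a, b, hg, hl, hh⟩ := good_of_splitsStrip h
      refine ⟨a + segWeight c, b + segWeight c, ?_, by omega, by omega⟩
      simpa using Good.finished hc hg
    · obtain ⟨a, b, hg, hl, hh⟩ := good_of_splitsStrip h
      refine ⟨a, b, ?_, hl, hh⟩
      simpa [← Multiset.cons_coe] using hg

theorem reply_of_replyOK {T : Table} {lo hi h : ℕ} {L : List ℕ}
    (hr : replyOK T lo hi L h = true) :
    ∃ N a b, SegMove 1 ↑L N ∧ Good T N a b ∧ lo ≤ a ∧ b ≤ hi := by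
  unfold replyOK at hr
  split at hr
  · simp at hr
  · next x hx =>
    simp only [Bool.and_eq_true, Nat.blt_eq] at hr
    obtain ⟨a, b, hg, hl, hh⟩ := good_of_splitsStrip hr.2
    refine ⟨_, a, b, ⟨x.1, h % 16, x.2, hr.1, ?_, rfl⟩, by simpa using hg, by omega, by omega⟩
    rw [Multiset.coe_eq_coe.2 (perm_of_takeOut hx), Multiset.cons_coe]

theorem replyOK_of_positionsOK {T : Table} {lo hi c p : ℕ} {rest : List ℕ} :
    ∀ {m h : ℕ}, positionsOK T lo hi rest c m h = true → p < m →
      ∃ h', replyOK T lo hi (cutLeft 3 c p :: cutRight 3 c p :: rest) h' = true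
  | 0, _, _, hp => absurd hp (Nat.not_lt_zero p)
  | m + 1, h, hm, hp => by
    simp only [positionsOK, Bool.and_eq_true] at hm
    obtain hp | rfl := Nat.lt_succ_iff_lt_or_eq.1 hp
    · exact replyOK_of_positionsOK hm.2 hp
    · exact ⟨_, hm.1⟩

theorem positionsOK_of_segmentsOK {T : Table} {lo hi c : ℕ} :
    ∀ {cs pre : List ℕ} {h : ℕ}, segmentsOK T lo hi pre cs h = true → c ∈ cs →
      ∃ (rest : List ℕ) (h' : ℕ), (↑(pre ++ cs) : Multiset ℕ) = c ::ₘ ↑rest ∧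
        positionsOK T lo hi rest c (c / 8) h' = true
  | [], _, _, _, hc => by simp at hc
  | d :: cs, pre, h, hs, hc => by
    simp only [segmentsOK, Bool.and_eq_true] at hs
    obtain rfl | hc := List.mem_cons.1 hc
    · exact ⟨pre ++ cs, h, by simp [← Multiset.coe_add, ← Multiset.cons_coe], hs.1⟩
    · obtain ⟨rest, h', hr, hp⟩ := positionsOK_of_segmentsOK hs.2 hc
      refine ⟨rest, h', ?_, hp⟩
      rw [← hr]
      simp [← Multiset.coe_add, ← Multiset.cons_coe]

theorem reply_of_entryOK {T : Table} {e : Entry} (he : entryOK T e = true) {N : Multiset ℕ}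
    (hN : SegMove 3 ↑e.segs N) :
    ∃ N' a b, SegMove 1 N N' ∧ Good T N' a b ∧ e.lo ≤ a ∧ b ≤ e.hi := by
  obtain ⟨c, p, M, hp, hM, rfl⟩ := hN
  simp only [entryOK, Bool.and_eq_true] at he
  have hc : c ∈ e.segs := by simp [← Multiset.mem_coe, hM]
  obtain ⟨rest, h, hr, hs⟩ := positionsOK_of_segmentsOK he.2 hc
  obtain ⟨h', hq⟩ := replyOK_of_positionsOK hs hp
  rw [List.nil_append, hM, Multiset.cons_inj_right] at hr
  rw [hr]
  exact reply_of_replyOK hq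

/-- The responder has a reply to every move from a position that splits into groups from a
correct table. -/
theorem Good.exists_reply {T : Table} (hT : T.all (entryOK T) = true) {M N : Multiset ℕ}
    {a b : ℕ} (hM : Good T M a b) (hN : SegMove 3 M N) :
    ∃ N' a' b', SegMove 1 N N' ∧ Good T N' a' b' ∧ a ≤ a' ∧ b' ≤ b := by
  induction hM generalizing N with
  | zero =>
    obtain ⟨c, p, M', -, h, -⟩ := hN
    exact absurd h (Multiset.zero_ne_cons)
  | @finished c M a b hc _ ih =>
    obtain ⟨d, p, M', hp, h, rfl⟩ := hN
    obtain ⟨rfl, -⟩ | ⟨-, K, rfl, rfl⟩ := Multiset.cons_eq_cons.1 h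
    · omega
    · obtain ⟨N', a', b', hm, hg, ha, hb⟩ := ih ⟨d, p, K, hp, rfl, rfl⟩
      refine ⟨_, _, _, ?_, hg.finished hc, by omega, by omega⟩
      simpa [Multiset.singleton_add, Multiset.cons_swap _ c] using hm.add_left {c}
  | @entry e M a b he hM ih =>
    obtain ⟨d, p, M', hp, h, rfl⟩ := hN
    have hd : d ∈ (↑e.segs : Multiset ℕ) + M := by simp [h]
    obtain hd | hd := Multiset.mem_add.1 hd
    · obtain ⟨K, hK⟩ := Multiset.exists_cons_of_mem hd
      rw [hK, Multiset.cons_add, Multiset.cons_inj_right] at h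
      subst h
      obtain ⟨N', a', b', hm, hg, ha, hb⟩ :=
        reply_of_entryOK (Table.apply_of_all hT he) ⟨d, p, K, hp, hK, rfl⟩
      refine ⟨_, _, _, ?_, hM.add hg, by omega, by omega⟩
      simpa [add_comm] using hm.add_left M
    · obtain ⟨K, rfl⟩ := Multiset.exists_cons_of_mem hd
      rw [Multiset.add_cons, Multiset.cons_inj_right] at h
      subst h
      obtain ⟨N', a', b', hm, hg, ha, hb⟩ := ih ⟨d, p, K, hp, rfl, rfl⟩
      refine ⟨_, _, _, ?_, hg.entry he, by omega, by omega⟩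
      simpa using hm.add_left ↑e.segs

theorem Good.bounds {T : Table} (hT : T.all (entryOK T) = true) {M : Multiset ℕ} {a b : ℕ}
    (hM : Good T M a b) (h : ∀ c ∈ M, c < 8) :
    a ≤ (M.map segWeight).sum ∧ (M.map segWeight).sum ≤ b := by
  induction hM with
  | zero => simp
  | finished hc _ ih =>
    have := ih fun d hd => h d (Multiset.mem_cons_of_mem hd)
    simp only [Multiset.map_cons, Multiset.sum_cons]
    omega
  | entry he _ _ =>
    have := Table.apply_of_all hT he
    simp only [entryOK, Bool.and_eq_true, List.any_eq_true, Nat.blt_eq] at this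
    obtain ⟨⟨c, hc, h7⟩, -⟩ := this
    have := h c (by simp [hc])
    omega

/-! ### The table of replies -/

def responseTableLLLL : Table :=
  .node (.node (.node (.node (.node (.node .leaf 118098
  [⟨[9, 9], 4, 4, 8224⟩] .leaf) 159049
  [⟨[10, 9], 3, 5, 8224⟩]
  .leaf) 200000
  [⟨[10, 10], 4, 4, 8224⟩]
  (.node .leaf 220100
  [⟨[11, 9], 2, 6, 8224⟩] .leaf)) 261051
  [⟨[11, 10], 1, 7, 8224⟩]
  (.node (.node (.node .leaf 307881
  [⟨[12, 9], 3, 5, 8224⟩] .leaf) 322102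
  [⟨[11, 11], 4, 4, 8224⟩]
  .leaf) 348832
  [⟨[12, 10], 2, 6, 8224⟩]
  (.node .leaf 409883
  [⟨[12, 11], 3, 5, 8224⟩] .leaf))) 497664
  [⟨[12, 12], 4, 4, 8224⟩]
  (.node (.node (.node (.node .leaf 596873
  [⟨[14, 9], 1, 7, 8224⟩] .leaf) 698875
  [⟨[14, 11], 3, 5, 8224⟩]
  .leaf) 786656
  [⟨[14, 12], 2, 6, 8224⟩]
  (.node .leaf 1048576
  [⟨[16], 4, 4, 4096⟩] .leaf)) 1075648
  [⟨[14, 14], 4, 4, 8224⟩]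
  (.node (.node (.node .leaf 1419857
  [⟨[17], 3, 5, 4096⟩] .leaf) 1680908
  [⟨[17, 11, 10], 6, 10, 824188976⟩]
  .leaf) 1727738
  [⟨[17, 12, 9], 6, 8, 824184880⟩]
  (.node .leaf 1768689
  [⟨[17, 12, 10], 5, 9, 824184880⟩] .leaf)))) 1829740
  [⟨[17, 12, 11], 4, 8, 539037728⟩]
  (.node (.node (.node (.node (.node .leaf 1889568
  [⟨[18], 4, 4, 4096⟩] .leaf) 2016730
  [⟨[17, 14, 9], 4, 10, 824184880⟩]
  .leaf) 2476099
  [⟨[19], 3, 5, 4096⟩]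
  (.node .leaf 2704177
  [⟨[17, 14, 12, 12, 12], 7, 13, 89340438908976⟩] .leaf)) 2783980
  [⟨[19, 12, 9], 4, 8, 807415808⟩]
  (.node (.node (.node .leaf 2803386
  [⟨[17, 14, 14, 12, 9], 10, 12, 89404579254352⟩] .leaf) 2905388
  [⟨[17, 14, 14, 12, 11], 8, 12, 35464084983872⟩]
  .leaf) 3188546
  [⟨[17, 17, 12, 10], 10, 12, 54014047690784⟩]
  (.node .leaf 3200000
  [⟨[20], 2, 6, 4096⟩] .leaf))) 3262755
  [⟨[19, 14, 12], 5, 9, 807415808⟩]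
  (.node (.node (.node (.node .leaf 3420100
  [⟨[20, 11, 9], 6, 8, 807481376⟩] .leaf) 3461051
  [⟨[20, 11, 10], 5, 9, 807481376⟩]
  .leaf) 3609883
  [⟨[20, 12, 11], 5, 9, 538976256⟩]
  (.node .leaf 3626370
  [⟨[17, 17, 14, 12], 6, 12, 54014064533793⟩] .leaf)) 3672638
  [⟨[19, 14, 12, 12, 11], 8, 12, 35460057411632⟩]
  (.node (.node .leaf 3760419
  [⟨[19, 14, 12, 12, 12], 9, 13, 35322886893568⟩] .leaf) 3796873
  [⟨[20, 14, 9], 5, 9, 807481376⟩]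
  (.node .leaf 3837824
  [⟨[20, 14, 10], 6, 10, 807481376⟩] .leaf))))

def responseTableLLLR : Table :=
  .node (.node (.node (.node (.node (.node .leaf 3917764
  [⟨[20, 12, 12, 11, 9], 10, 12, 88240643133504⟩] .leaf) 3986656
  [⟨[20, 14, 12], 4, 8, 807415808⟩]
  .leaf) 4104754
  [⟨[20, 14, 12, 9, 9], 8, 12, 35529045323776⟩]
  (.node .leaf 4107547
  [⟨[20, 12, 12, 12, 11], 9, 13, 35322351067136⟩] .leaf)) 4206756
  [⟨[20, 14, 12, 11, 9], 8, 12, 88099177648128⟩]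
  (.node (.node (.node .leaf 4247707
  [⟨[20, 14, 12, 11, 10], 7, 13, 88099714519040⟩] .leaf) 4294537
  [⟨[20, 14, 12, 12, 9], 9, 13, 35322886959136⟩]
  .leaf) 4308758
  [⟨[20, 14, 12, 11, 11], 8, 12, 35528778985472⟩]
  (.node .leaf 4335488
  [⟨[20, 14, 12, 12, 10], 10, 14, 35322886959136⟩] .leaf))) 4593745
  [⟨[18, 17, 14, 12, 12, 12], 11, 17, 5855015004339703808⟩]
  (.node (.node (.node (.node .leaf 4685531
  [⟨[20, 14, 14, 12, 11], 9, 13, 53051976073216⟩] .leaf) 4794956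
  [⟨[18, 17, 14, 14, 12, 11], 10, 16, 2324227187501174784⟩]
  .leaf) 4968689
  [⟨[20, 17, 12, 10], 9, 13, 70506739933216⟩]
  (.node .leaf 5029740
  [⟨[20, 17, 12, 11], 8, 12, 71605965299968⟩] .leaf)) 5153632
  [⟨[22], 4, 4, 4096⟩]
  (.node (.node .leaf 5180276
  [⟨[19, 17, 14, 12, 12, 12], 10, 16, 6940117605248155648⟩] .leaf) 5216730
  [⟨[20, 17, 14, 9], 8, 12, 54086793707568⟩]
  (.node .leaf 5257681
  [⟨[20, 17, 14, 10], 9, 13, 54086793764912⟩] .leaf)))) 5318732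
  [⟨[20, 17, 14, 11], 8, 12, 52988087378224⟩]
  (.node (.node (.node (.node (.node .leaf 5378572
  [⟨[20, 17, 12, 12, 11, 10], 10, 16, 5845778283376959584⟩] .leaf) 5406513
  [⟨[20, 17, 14, 12], 5, 11, 54086793699617⟩, ⟨[20, 17, 14, 12], 7, 13, 52987279982592⟩]
  .leaf) 5714394
  [⟨[20, 17, 14, 12, 12, 9], 12, 18, 2314938380120506416⟩]
  (.node .leaf 5816396
  [⟨[20, 17, 14, 12, 12, 11], 10, 16, 2314903127033135200⟩] .leaf)) 5876224
  [⟨[20, 18, 14, 12], 8, 12, 52982985015296⟩]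
  (.node (.node (.node .leaf 5904177
  [⟨[20, 17, 14, 12, 12, 12], 9, 15, 2314904295262134528⟩] .leaf) 5983980
  [⟨[20, 19, 12, 9], 8, 12, 70575711076352⟩]
  .leaf) 6085982
  [⟨[20, 19, 12, 11], 8, 12, 52915070836736⟩]
  (.node .leaf 6193169
  [⟨[20, 17, 14, 14, 12, 12], 11, 17, 3467824627882926384⟩] .leaf))) 6198326
  [⟨[20, 18, 14, 12, 11, 11], 10, 16, 2332917589962932224⟩]
  (.node (.node (.node (.node .leaf 6462755
  [⟨[20, 19, 14, 12], 7, 11, 52914533965824⟩] .leaf) 6559049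
  [⟨[20, 20, 10, 9], 9, 15, 54014584635425⟩]
  .leaf) 6661051
  [⟨[20, 20, 11, 10], 9, 13, 52918847873313⟩]
  (.node .leaf 6707881
  [⟨[20, 20, 12, 9], 9, 15, 52919099535393⟩] .leaf)) 6723806
  [⟨[20, 19, 14, 12, 11, 10], 10, 16, 6935596346053255264⟩]
  (.node (.node .leaf 6748832
  [⟨[20, 20, 12, 10], 10, 14, 52919099535393⟩] .leaf) 6770636
  [⟨[20, 19, 14, 12, 12, 9], 10, 16, 2323910460769845344⟩]
  (.node .leaf 6809883
  [⟨[20, 20, 12, 11], 7, 11, 52914533965824⟩] .leaf))))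

def responseTableLLL : Table :=
  .node responseTableLLLL 3859628
  [⟨[19, 14, 14, 12, 9], 8, 12, 88305067642880⟩] responseTableLLLR

def responseTableLLRL : Table :=
  .node (.node (.node (.node (.node (.node .leaf 6897664
  [⟨[20, 20, 12, 12], 8, 12, 52914802405376⟩] .leaf) 6922321
  [⟨[22, 17, 12, 10], 9, 13, 54082500825088⟩]
  .leaf) 6983372
  [⟨[22, 17, 12, 11], 8, 12, 35390802104320⟩]
  (.node .leaf 7098875
  [⟨[20, 20, 14, 11], 5, 11, 52914538160192⟩] .leaf)) 7117764
  [⟨[20, 20, 12, 12, 11, 9], 12, 18, 2314903122733961216⟩]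
  (.node (.node (.node .leaf 7186656
  [⟨[20, 20, 14, 12], 6, 10, 52914533965824⟩] .leaf) 7219766
  [⟨[20, 20, 12, 12, 11, 11], 10, 16, 2314938513806602320⟩]
  .leaf) 7296081
  [⟨[20, 18, 17, 14, 12], 9, 15, 4625214547202945329⟩, ⟨[20, 18, 17, 14, 12], 11, 17, 4629718009391370240⟩]
  (.node .leaf 7304754
  [⟨[20, 20, 14, 12, 9, 9], 8, 14, 2332917521511882752⟩] .leaf))) 7406756
  [⟨[20, 20, 14, 12, 11, 9], 10, 16, 2323910323330899968⟩]
  (.node (.node (.node (.node .leaf 7494537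
  [⟨[20, 20, 14, 12, 12, 9], 11, 17, 2323910460769853440⟩] .leaf) 7593620
  [⟨[20, 19, 17, 12, 12], 10, 16, 3540146104709488673⟩]
  .leaf) 7819857
  [⟨[20, 20, 17], 7, 11, 35322635301153⟩]
  (.node .leaf 7857809
  [⟨[22, 17, 14, 12, 12, 12], 11, 17, 6940117532233699328⟩] .leaf)) 7882612
  [⟨[20, 19, 17, 14, 12], 8, 14, 4620992491540197664⟩]
  (.node (.node .leaf 7937612
  [⟨[22, 19, 12, 9], 8, 12, 52983790309376⟩] .leaf) 8127738
  [⟨[20, 20, 17, 12, 9], 12, 18, 2314867939169353761⟩]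
  (.node .leaf 8168689
  [⟨[20, 20, 17, 12, 10], 11, 17, 2315149551582855168⟩] .leaf)))) 8229740
  [⟨[20, 20, 17, 12, 11], 10, 16, 2314867801459798016⟩]
  (.node (.node (.node (.node (.node .leaf 8317521
  [⟨[20, 20, 17, 12, 12], 9, 15, 2328378737514586145⟩] .leaf) 8435276
  [⟨[22, 19, 12, 12, 12, 9], 10, 16, 5773650183149609056⟩]
  .leaf) 8518732
  [⟨[20, 20, 17, 14, 11], 8, 14, 4620710947844005888⟩]
  (.node .leaf 8606513
  [⟨[20, 20, 17, 14, 12], 9, 15, 4620710810405052416⟩] .leaf)) 8763515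
  [⟨[22, 20, 12, 11], 9, 13, 35391335829504⟩]
  (.node (.node (.node .leaf 8886441
  [⟨[20, 20, 18, 14, 9], 11, 17, 4625513615441612833⟩] .leaf) 8914394
  [⟨[20, 20, 17, 14, 12, 12, 9], 14, 20, 152596101199679637712896⟩]
  .leaf) 9071396
  [⟨[22, 20, 12, 12, 11, 9], 10, 16, 5782692498056941568⟩]
  (.node .leaf 9076224
  [⟨[20, 20, 18, 14, 12], 10, 16, 4620710810405052416⟩] .leaf))) 9140288
  [⟨[22, 20, 14, 12], 8, 12, 70507256877056⟩]
  (.node (.node (.node (.node .leaf 9183980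
  [⟨[20, 20, 19, 12, 9], 10, 16, 3472310635319013376⟩, ⟨[20, 20, 19, 12, 9], 12, 24, 3467789305531928609⟩] .leaf) 9239714
  [⟨[20, 20, 17, 17], 10, 16, 1152939097600372769⟩, ⟨[20, 20, 17, 17], 12, 22, 2305879293904891937⟩]
  .leaf) 9258386
  [⟨[22, 20, 14, 12, 9, 9], 10, 16, 2332935114234793984⟩]
  (.node .leaf 9261179
  [⟨[22, 20, 12, 12, 12, 11], 11, 17, 2314885599804264448⟩] .leaf)) 9285982
  [⟨[20, 20, 19, 12, 11], 8, 14, 3467842082356338688⟩]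
  (.node (.node .leaf 9299337
  [⟨[22, 20, 14, 12, 10, 9], 11, 17, 2332935114234793984⟩] .leaf) 9373763
  [⟨[20, 20, 19, 12, 12], 9, 15, 3467842082358435872⟩]
  (.node .leaf 9547252
  [⟨[22, 19, 17, 12, 12], 10, 16, 3540128512255992097⟩] .leaf))))

def responseTableLLRR : Table :=
  .node (.node (.node (.node (.node (.node .leaf 9824674
  [⟨[25, 9], 6, 8, 537985024⟩] .leaf) 9865625
  [⟨[25, 10], 5, 9, 537985024⟩]
  .leaf) 9907881
  [⟨[20, 20, 20, 12, 9], 11, 17, 3467806897984249856⟩]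
  (.node .leaf 9926676
  [⟨[25, 11], 6, 10, 538968064⟩] .leaf)) 9948832
  [⟨[20, 20, 20, 12, 10], 10, 16, 3467806897984249856⟩]
  (.node (.node (.node .leaf 10009883
  [⟨[20, 20, 20, 12, 11], 9, 15, 3467842082893217792⟩] .leaf) 10014457
  [⟨[25, 12], 5, 7, 537919488⟩]
  .leaf) 10097664
  [⟨[20, 20, 20, 12, 12], 8, 14, 3467842082893217792⟩, ⟨[20, 20, 20, 12, 12], 10, 16, 3467842082893217792⟩]
  (.node .leaf 10173506
  [⟨[25, 12, 10, 9], 10, 12, 71683542155264⟩] .leaf))) 10295956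
  [⟨[20, 20, 19, 17], 8, 14, 2314885393650102337⟩]
  (.node (.node (.node (.node .leaf 10303449
  [⟨[25, 14], 5, 11, 538968064⟩] .leaf) 10472364
  [⟨[22, 20, 17, 14, 11], 10, 16, 5782710089173438464⟩]
  .leaf) 10560145
  [⟨[22, 20, 17, 14, 12], 9, 15, 5778417527342239744⟩, ⟨[22, 20, 17, 14, 12], 11, 17, 5778417390421282816⟩]
  (.node .leaf 10793620
  [⟨[20, 20, 19, 17, 12, 12], 12, 18, 151725645517232598425600⟩] .leaf)) 11019857
  [⟨[20, 20, 20, 17], 7, 13, 2314885393377402880⟩, ⟨[20, 20, 20, 17], 11, 23, 2387207011673640993⟩]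
  (.node (.node .leaf 11239614
  [⟨[22, 20, 19, 12, 11], 10, 16, 3467859674542379008⟩] .leaf) 11429740
  [⟨[20, 20, 20, 17, 12, 11], 12, 18, 227560196857169799290880⟩]
  (.node .leaf 11434314
  [⟨[25, 17, 12], 6, 10, 36353174671393⟩] .leaf)))) 11517521
  [⟨[20, 20, 20, 17, 12, 12], 13, 19, 227265039981075629097216⟩]
  (.node (.node (.node (.node (.node .leaf 11616387
  [⟨[22, 20, 19, 14, 12], 11, 17, 3467789306605604864⟩] .leaf) 11940425
  [⟨[26, 9], 5, 7, 537919488⟩]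
  .leaf) 12042427
  [⟨[26, 11], 5, 7, 537919488⟩]
  (.node .leaf 12051296
  [⟨[22, 20, 20, 12, 12], 10, 16, 5782692291361640448⟩] .leaf)) 12076099
  [⟨[20, 20, 20, 19], 11, 23, 2387225841097580865⟩]
  (.node (.node (.node .leaf 12130208
  [⟨[26, 12], 6, 6, 537919488⟩] .leaf) 12419200
  [⟨[26, 14], 4, 8, 537919488⟩]
  .leaf) 12509962
  [⟨[25, 17, 14, 14, 12], 8, 14, 4692821524633096225⟩]
  (.node .leaf 12800000
  [⟨[20, 20, 20, 20], 12, 24, 2387225703656530209⟩] .leaf))) 13091244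
  [⟨[22, 22, 19, 12, 9], 10, 16, 3472363273901314048⟩]
  (.node (.node (.node (.node .leaf 13495956
  [⟨[20, 20, 20, 19, 17], 10, 16, 152003477045560827977728⟩] .leaf) 13503449
  [⟨[25, 20, 14], 5, 11, 35322617397248⟩]
  .leaf) 13811330
  [⟨[25, 20, 14, 12, 9], 8, 14, 5927336490828828752⟩]
  (.node .leaf 13839057
  [⟨[26, 17, 14], 5, 11, 36353142235425⟩] .leaf)) 13852281
  [⟨[25, 20, 14, 12, 10], 9, 15, 5927355380094996560⟩]
  (.node (.node .leaf 13913332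
  [⟨[25, 20, 14, 12, 11], 8, 14, 2324475480364814368⟩] .leaf) 14336721
  [⟨[26, 17, 14, 12, 12], 9, 15, 2328397360491659264⟩]
  (.node .leaf 14407956
  [⟨[27, 9], 6, 10, 537923585⟩] .leaf))))

def responseTableLLR : Table :=
  .node responseTableLLRL 9662755
  [⟨[20, 20, 19, 14, 12], 9, 15, 3467789305798205440⟩] responseTableLLRR

def responseTableLL : Table :=
  .node responseTableLLL 6826370
  [⟨[20, 17, 17, 14, 12], 8, 14, 3539847041304830208⟩] responseTableLLR

def responseTableLRLL : Table :=
  .node (.node (.node (.node (.node (.node .leaf 14509958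
  [⟨[27, 11], 6, 8, 571473952⟩] .leaf) 14597739
  [⟨[27, 12], 5, 7, 554704896⟩]
  .leaf) 14634314
  [⟨[25, 20, 17, 12], 8, 14, 3467826834689757233⟩, ⟨[25, 20, 17, 12], 12, 22, 3544332975998050560⟩]
  (.node .leaf 14886731
  [⟨[27, 14], 5, 9, 571473952⟩] .leaf)) 14923306
  [⟨[25, 20, 17, 14], 8, 14, 2382459389988569088⟩]
  (.node (.node (.node .leaf 15305182
  [⟨[26, 19, 14, 12, 11], 8, 14, 4625232140195332096⟩] .leaf) 15392963
  [⟨[26, 19, 14, 12, 12], 9, 15, 4625232139121590272⟩]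
  .leaf) 15420970
  [⟨[25, 20, 17, 14, 12, 12], 12, 18, 152003553626889303162880⟩]
  (.node .leaf 15492172
  [⟨[26, 19, 14, 14, 9], 8, 14, 4625232346622197760⟩] .leaf))) 15541724
  [⟨[25, 20, 19, 10], 12, 22, 2310382962269495553⟩]
  (.node (.node (.node (.node .leaf 15728625
  [⟨[26, 18, 17, 14], 9, 15, 2382457048158712096⟩] .leaf) 15927081
  [⟨[26, 20, 14, 12, 9], 11, 17, 5778436219022082048⟩]
  .leaf) 16029083
  [⟨[26, 20, 14, 12, 11], 9, 15, 5778153643731583040⟩]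
  (.node .leaf 16224674
  [⟨[25, 20, 20, 9], 12, 22, 4688283565519077376⟩] .leaf)) 16414457
  [⟨[25, 20, 20, 12], 9, 15, 4769312142825357312⟩]
  (.node (.node .leaf 16560282
  [⟨[26, 20, 17, 9], 8, 14, 3467807172329480256⟩] .leaf) 16587946
  [⟨[25, 22, 17, 12], 8, 14, 3463323157749829681⟩]
  (.node .leaf 16750065
  [⟨[26, 20, 17, 12], 9, 15, 2382439662133190976⟩] .leaf)))) 16812820
  [⟨[26, 19, 17, 14, 12, 12], 12, 18, 378972292742590277615616⟩]
  (.node (.node (.node (.node (.node .leaf 17039057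
  [⟨[26, 20, 17, 14], 9, 15, 3472310634514743296⟩] .leaf) 17269417
  [⟨[28, 9], 5, 9, 537923585⟩]
  .leaf) 17310368
  [⟨[28, 10], 6, 10, 537923585⟩]
  (.node .leaf 17371419
  [⟨[28, 11], 5, 9, 571473952⟩] .leaf)) 17459200
  [⟨[28, 12], 4, 8, 537919488⟩]
  (.node (.node (.node .leaf 17536721
  [⟨[26, 20, 17, 14, 12, 12], 13, 19, 152023090274851489906737⟩] .leaf) 17720251
  [⟨[28, 12, 11, 10], 7, 13, 70506724196384⟩]
  .leaf) 17748192
  [⟨[28, 14], 6, 10, 571473952⟩]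
  (.node .leaf 17834314
  [⟨[25, 20, 20, 17, 12], 12, 18, 387533968848917794652160⟩] .leaf))) 18086731
  [⟨[27, 20, 14], 5, 11, 35326107066368⟩]
  (.node (.node (.node (.node .leaf 18097024
  [⟨[28, 14, 12, 10], 8, 12, 70575712108592⟩] .leaf) 18123306
  [⟨[25, 20, 20, 17, 14], 10, 16, 388453851554590365847584⟩]
  .leaf) 18158075
  [⟨[28, 14, 12, 11], 9, 13, 35399694024736⟩]
  (.node .leaf 18394612
  [⟨[27, 20, 14, 12, 9], 8, 14, 5782938925032034304⟩] .leaf)) 18530208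
  [⟨[26, 20, 20, 12], 10, 16, 2319353945535807488⟩]
  (.node (.node .leaf 18584395
  [⟨[27, 20, 14, 12, 12], 9, 15, 2323910326589865985⟩] .leaf) 18791276
  [⟨[28, 17, 11], 8, 12, 35253629489153⟩]
  (.node .leaf 18879057
  [⟨[28, 17, 12], 5, 11, 36353142235393⟩] .leaf))))

def responseTableLRLR : Table :=
  .node (.node (.node (.node (.node (.node .leaf 19226164
  [⟨[26, 20, 19, 17, 12], 12, 18, 227266206342116753276928⟩] .leaf) 19288940
  [⟨[28, 17, 12, 12, 11], 10, 16, 2314885530819514401⟩]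
  .leaf) 19475930
  [⟨[28, 17, 14, 12, 9], 10, 16, 4629735739286945856⟩]
  (.node .leaf 19515156
  [⟨[26, 20, 19, 17, 14], 10, 16, 227562502736742339051520⟩] .leaf)) 19665713
  [⟨[28, 17, 14, 12, 12], 11, 17, 3467806967241642016⟩]
  (.node (.node (.node .leaf 19950065
  [⟨[26, 20, 20, 17, 12], 13, 19, 226971058473152567836736⟩] .leaf) 19954705
  [⟨[28, 17, 14, 14, 12], 9, 15, 4692786340228571440⟩]
  .leaf) 20076938
  [⟨[25, 22, 20, 17, 14], 12, 18, 157040600159232138936320⟩]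
  (.node .leaf 20239057
  [⟨[26, 20, 20, 17, 14], 11, 17, 227856497648875009474560⟩] .leaf))) 20298914
  [⟨[28, 17, 17, 12], 12, 22, 4697887877149757441⟩]
  (.node (.node (.node (.node .leaf 20573123
  [⟨[28, 19, 14, 12, 10], 11, 17, 5778188759385243680⟩] .leaf) 20879300
  [⟨[28, 20, 12, 11, 9], 10, 16, 5782657243892678656⟩]
  .leaf) 20948192
  [⟨[28, 20, 14], 8, 12, 36421323722753⟩]
  (.node .leaf 20967081
  [⟨[28, 20, 12, 12, 9], 11, 17, 5782674836113326128⟩] .leaf)) 20997739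
  [⟨[27, 20, 20, 12], 9, 15, 4769364919920361472⟩]
  (.node (.node .leaf 21256073
  [⟨[28, 20, 14, 12, 9], 9, 15, 5787178641868726272⟩] .leaf) 21297024
  [⟨[28, 20, 14, 12, 10], 8, 14, 5778171442077114368⟩, ⟨[28, 20, 14, 12, 10], 10, 16, 5778171442077114368⟩]
  (.node .leaf 21305620
  [⟨[27, 20, 20, 12, 12, 9], 12, 18, 455125005383040187252800⟩] .leaf)))) 21358075
  [⟨[28, 20, 14, 12, 11], 9, 15, 2319390229420572673⟩, ⟨[28, 20, 14, 12, 11], 11, 17, 2319390229423718448⟩]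
  (.node (.node (.node (.node (.node .leaf 21647001
  [⟨[26, 25], 7, 9, 17592187092992⟩] .leaf) 21930225
  [⟨[28, 20, 17, 10], 9, 15, 3472310635052662784⟩]
  .leaf) 21991276
  [⟨[28, 20, 17, 11], 8, 14, 4625232139122638848⟩]
  (.node .leaf 22079057
  [⟨[28, 20, 17, 12], 9, 15, 4625249731308683265⟩, ⟨[28, 20, 17, 12], 11, 17, 4697853714476642305⟩] .leaf)) 22340108
  [⟨[28, 20, 17, 12, 11, 10], 14, 20, 227859956448574007414864⟩]
  (.node (.node (.node .leaf 22358985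
  [⟨[28, 20, 18, 9], 11, 17, 3472328364140798209⟩] .leaf) 22386938
  [⟨[28, 20, 17, 12, 12, 9], 14, 20, 152596083220258035335232⟩]
  .leaf) 22488940
  [⟨[28, 20, 17, 12, 12, 11], 12, 18, 151708414726503486521345⟩]
  (.node .leaf 22675930
  [⟨[28, 20, 17, 14, 12, 9], 12, 18, 303416662767181637967872⟩] .leaf))) 22777932
  [⟨[28, 20, 17, 14, 12, 11], 14, 20, 227270809020876048044096⟩]
  (.node (.node (.node (.node .leaf 22870870
  [⟨[28, 20, 18, 12, 11, 11], 12, 18, 378973382578515730235440⟩] .leaf) 23135299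
  [⟨[28, 20, 19, 12], 9, 15, 3468089609376759856⟩, ⟨[28, 20, 19, 12], 11, 23, 2387244322355425585⟩]
  .leaf) 23443180
  [⟨[28, 20, 19, 12, 12, 9], 12, 18, 454827547131114818633792⟩]
  (.node .leaf 23762752
  [⟨[26, 26], 8, 8, 17592187092992⟩] .leaf)) 23771419
  [⟨[28, 20, 20, 11], 11, 23, 4692805994031353857⟩]
  (.node (.node .leaf 23859200
  [⟨[28, 20, 20, 12], 12, 24, 4693087404583555073⟩] .leaf) 23968625
  [⟨[28, 20, 18, 17, 12], 13, 19, 156727000918487239491584⟩]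
  (.node .leaf 24032689
  [⟨[28, 22, 17, 12], 9, 15, 3463320958728740865⟩] .leaf))))

def responseTableLRL : Table :=
  .node responseTableLRLL 19068764
  [⟨[27, 20, 17, 10], 12, 22, 4625249731878060065⟩] responseTableLRLR

def responseTableLRRL : Table :=
  .node (.node (.node (.node (.node (.node .leaf 24461051
  [⟨[30, 11], 5, 7, 554704896⟩] .leaf) 24463364
  [⟨[27, 25, 12, 10], 12, 22, 4769628664754081793⟩]
  .leaf) 24530353
  [⟨[28, 22, 17, 12, 12, 12], 13, 19, 151711792426233174753281⟩]
  (.node .leaf 24548832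
  [⟨[30, 12], 6, 6, 554704896⟩] .leaf)) 24555156
  [⟨[28, 20, 19, 17, 12], 14, 20, 227282338235981742739505⟩]
  (.node (.node (.node .leaf 24844148
  [⟨[28, 20, 19, 17, 14], 12, 18, 227284653174151376277584⟩] .leaf) 25812832
  [⟨[28, 22, 20, 12], 10, 16, 2319353950386520096⟩]
  .leaf) 26032932
  [⟨[28, 22, 20, 12, 11, 9], 14, 20, 454531259850344587333664⟩]
  (.node .leaf 26230283
  [⟨[27, 26], 7, 9, 17592187101184⟩] .leaf))) 26508788
  [⟨[28, 22, 19, 17, 12], 12, 18, 227268512185125953413152⟩]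
  (.node (.node (.node (.node .leaf 26975993
  [⟨[28, 25], 7, 13, 18691698720769⟩] .leaf) 27232689
  [⟨[28, 22, 20, 17, 12], 13, 19, 302528922216589534691360⟩]
  .leaf) 27283874
  [⟨[28, 25, 12, 9], 12, 22, 2319654120816906241⟩]
  (.node .leaf 28158715
  [⟨[30, 20, 12, 12, 11], 9, 15, 5782674904798212096⟩] .leaf)) 29091744
  [⟨[28, 26], 6, 10, 17592187092992⟩]
  (.node (.node .leaf 30921484
  [⟨[28, 26, 17, 12, 11], 12, 18, 151725636456156740276304⟩] .leaf) 30962649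
  [⟨[28, 25, 20, 14, 12], 11, 17, 383436481863234193859073⟩, ⟨[28, 25, 20, 14, 12], 13, 19, 227893400162775959945280⟩]
  (.node .leaf 31559275
  [⟨[28, 27], 7, 13, 17592203870209⟩] .leaf)))) 31595850
  [⟨[28, 25, 20, 17], 10, 16, 237044138425216490536994⟩]
  (.node (.node (.node (.node (.node .leaf 32652092
  [⟨[28, 25, 20, 19], 14, 26, 76776520122525992095745⟩] .leaf) 33554432
  [⟨[32], 2, 8, 268435456⟩]
  .leaf) 34065625
  [⟨[30, 25], 7, 9, 17592187101184⟩]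
  (.node .leaf 34420736
  [⟨[28, 28], 8, 12, 17592203870209⟩] .leaf)) 34830619
  [⟨[28, 28, 12, 11], 9, 15, 2315166867836108801⟩]
  (.node (.node (.node .leaf 35207392
  [⟨[28, 28, 14, 12], 10, 14, 3476814096720986113⟩] .leaf) 35256939
  [⟨[28, 27, 20, 12, 12], 11, 17, 378973378620412383985696⟩]
  .leaf) 36179132
  [⟨[28, 27, 20, 17], 14, 26, 227560197402527852924929⟩]
  (.node .leaf 38685482
  [⟨[30, 25, 20, 17], 14, 26, 226674757645230832353280⟩] .leaf))) 39135393
  [⟨[33], 5, 9, 301989888⟩]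
  (.node (.node (.node (.node .leaf 39484225
  [⟨[33, 12, 10], 9, 11, 52918578381057⟩] .leaf) 41611492
  [⟨[33, 19], 6, 10, 35322350010625⟩]
  .leaf) 41960324
  [⟨[33, 19, 12, 10], 12, 22, 2314867801460900129⟩]
  (.node .leaf 42596444
  [⟨[33, 20, 11, 10], 12, 22, 2315149482594935040⟩] .leaf)) 42643274
  [⟨[33, 20, 12, 9], 12, 22, 3540128516563534080⟩]
  (.node (.node .leaf 43122049
  [⟨[33, 20, 14, 12], 7, 13, 4837182796852105216⟩] .leaf) 43427889
  [⟨[30, 28, 17, 12, 12], 11, 17, 232009320962276762591296⟩]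
  (.node .leaf 44541906
  [⟨[33, 20, 17, 14, 12], 10, 16, 393138177014246998540337⟩] .leaf))))

def responseTableLRRR : Table :=
  .node (.node (.node (.node (.node (.node .leaf 45075681
  [⟨[33, 22, 14, 12], 9, 15, 4625830411153448960⟩] .leaf) 45435424
  [⟨[34], 4, 8, 268435456⟩]
  .leaf) 45535393
  [⟨[33, 20, 20], 11, 21, 3612205970262917377⟩]
  (.node .leaf 45594473
  [⟨[34, 10, 9], 9, 11, 54013795041537⟩] .leaf)) 45696475
  [⟨[34, 11, 10], 9, 11, 52918578381057⟩]
  (.node (.node (.node .leaf 45743305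
  [⟨[34, 12, 9], 9, 11, 52918578381057⟩] .leaf) 45784256
  [⟨[34, 12, 10], 10, 10, 52918578381057⟩]
  .leaf) 45845307
  [⟨[34, 12, 11], 7, 11, 35322079481856⟩]
  (.node .leaf 46033057
  [⟨[33, 20, 20, 12, 12], 11, 17, 393196970976326793039872⟩] .leaf))) 46222080
  [⟨[34, 14, 12], 6, 10, 52914265526272⟩]
  (.node (.node (.node (.node .leaf 46483131
  [⟨[34, 14, 12, 11, 10], 9, 15, 5778206489273438208⟩] .leaf) 46570912
  [⟨[34, 14, 12, 12, 10], 10, 16, 2319389198894764032⟩]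
  .leaf) 47641937
  [⟨[34, 17, 14, 12], 7, 13, 4620710947575562240⟩]
  (.node .leaf 48011492
  [⟨[33, 20, 20, 19], 14, 26, 75561475931885373751552⟩] .leaf)) 48275138
  [⟨[34, 17, 17], 12, 20, 2314903191471325441⟩]
  (.node (.node .leaf 48959230
  [⟨[34, 19, 14, 12, 11, 10], 12, 18, 454531242134944788516864⟩] .leaf) 49001018
  [⟨[33, 25, 10], 12, 20, 3463549588727726337⟩]
  (.node .leaf 49045307
  [⟨[34, 20, 12, 11], 7, 13, 3539864491753734144⟩] .leaf)))) 49133088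
  [⟨[34, 20, 12, 12], 8, 14, 3540163558916493312⟩]
  (.node (.node (.node (.node (.node .leaf 49334299
  [⟨[34, 20, 14, 11], 7, 13, 3467807172593717248⟩] .leaf) 49422080
  [⟨[34, 20, 14, 12], 6, 12, 3468088372692520960⟩, ⟨[34, 20, 14, 12], 8, 14, 3468088372692520960⟩]
  .leaf) 50841937
  [⟨[34, 20, 17, 14, 12], 11, 17, 378675915302005081378816⟩]
  (.node .leaf 51521406
  [⟨[34, 20, 19, 12, 11], 10, 16, 227267345787937575931904⟩] .leaf)) 51835424
  [⟨[34, 20, 20], 12, 22, 1162227981764067585⟩]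
  (.node (.node (.node .leaf 52521875
  [⟨[35], 3, 7, 285212672⟩, ⟨[35], 5, 9, 268439554⟩] .leaf) 53657363
  [⟨[35, 14, 12, 12, 10], 11, 17, 5854732429850324992⟩]
  .leaf) 55260098
  [⟨[34, 25, 9], 12, 20, 2382685678142030081⟩]
  (.node .leaf 55495638
  [⟨[35, 19, 12, 12], 8, 14, 4697572312480743425⟩] .leaf))) 55738873
  [⟨[34, 25, 14], 7, 13, 2382404203147431936⟩]
  (.node (.node (.node (.node .leaf 56029756
  [⟨[35, 20, 12, 9], 8, 14, 3467807997496918048⟩] .leaf) 56594593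
  [⟨[33, 28, 12], 11, 21, 2387488349748339248⟩]
  .leaf) 56857363
  [⟨[35, 20, 14, 12, 12, 10], 13, 19, 463975975100684370468897⟩]
  (.node .leaf 59070692
  [⟨[33, 28, 19, 12], 14, 26, 151410879878205181796864⟩] .leaf)) 59419539
  [⟨[35, 20, 20, 12, 12], 11, 17, 388455148628666713391104⟩]
  (.node (.node .leaf 60083585
  [⟨[33, 28, 20, 14], 11, 17, 307564946362896439312641⟩] .leaf) 60466176
  [⟨[36], 2, 6, 285212672⟩, ⟨[36], 6, 10, 268439554⟩]
  (.node .leaf 61183388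
  [⟨[35, 22, 20, 12, 9], 12, 18, 227562565732981879603504⟩] .leaf))))

def responseTableLRR : Table :=
  .node responseTableLRRL 44773732
  [⟨[28, 27, 25, 20, 12], 14, 20, 20484190812020337973707940386⟩] responseTableLRRR

def responseTableLR : Table :=
  .node responseTableLRL 24167081
  [⟨[28, 20, 20, 12, 12, 9], 13, 19, 454234945424969540042816⟩] responseTableLRR

def responseTableL : Table :=
  .node responseTableLL 14448907
  [⟨[27, 10], 5, 11, 537923585⟩] responseTableLR

def responseTableRLLL : Table :=
  .node (.node (.node (.node (.node (.node .leaf 62295916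
  [⟨[36, 17, 12, 11], 8, 14, 4697272210245558272⟩] .leaf) 62672689
  [⟨[36, 17, 14, 12], 9, 15, 4697553616218624032⟩]
  .leaf) 62793580
  [⟨[36, 17, 12, 12, 12, 11], 12, 18, 151708342633794348593200⟩]
  (.node .leaf 62806843
  [⟨[34, 28, 11], 9, 15, 2382421799646331137⟩] .leaf)) 62894624
  [⟨[34, 28, 12], 12, 22, 2382421800167547440⟩]
  (.node (.node (.node .leaf 63974057
  [⟨[36, 20, 12, 9], 9, 15, 3468123707658993664⟩] .leaf) 64015008
  [⟨[36, 20, 12, 10], 10, 16, 3468088523286904832⟩]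
  .leaf) 64076059
  [⟨[36, 20, 12, 11], 9, 15, 4697571221288517921⟩]
  (.node .leaf 64452832
  [⟨[36, 20, 14, 12], 10, 14, 3472627156691980289⟩, ⟨[36, 20, 14, 12], 8, 14, 3472627156691980289⟩] .leaf))) 65086033
  [⟨[36, 20, 17], 9, 15, 3544650807605526785⟩]
  (.node (.node (.node (.node .leaf 65393914
  [⟨[36, 20, 17, 12, 9], 12, 18, 232633055981181289365504⟩] .leaf) 65495916
  [⟨[36, 20, 17, 12, 11], 14, 20, 393435688443927955837008⟩]
  .leaf) 65736332
  [⟨[35, 25, 20, 12], 10, 16, 312580087936747922522368⟩]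
  (.node .leaf 65784908
  [⟨[36, 20, 17, 14, 11], 12, 18, 388713263997128869417024⟩] .leaf)) 65872689
  [⟨[36, 20, 17, 14, 12], 11, 17, 302822917181504145588226⟩, ⟨[36, 20, 17, 14, 12], 13, 19, 388471136457865576845314⟩]
  (.node (.node .leaf 66552158
  [⟨[36, 20, 19, 12, 11], 12, 18, 231989712271919617671473⟩] .leaf) 67449548
  [⟨[36, 22, 17, 12, 11], 12, 18, 383398299781475448463392⟩]
  (.node .leaf 73181075
  [⟨[35, 28, 20, 12], 11, 17, 312565175954267809251585⟩] .leaf)))) 73680633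
  [⟨[36, 25, 20, 12], 13, 19, 316693707078808633348145⟩]
  (.node (.node (.node (.node (.node .leaf 73969625
  [⟨[36, 25, 20, 14], 11, 17, 316993466352243797205552⟩] .leaf) 74600932
  [⟨[35, 28, 20, 17, 12], 14, 20, 25706911211912958195394412801⟩]
  .leaf) 77925376
  [⟨[36, 28, 12], 8, 14, 3463268255467045168⟩]
  (.node .leaf 78263915
  [⟨[36, 27, 20, 12], 11, 17, 231989937415471612567841⟩] .leaf)) 79235168
  [⟨[38], 4, 8, 268435456⟩]
  (.node (.node (.node .leaf 79345233
  [⟨[36, 28, 17, 12], 11, 17, 226971053933268784119808⟩] .leaf) 79683772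
  [⟨[36, 27, 20, 17, 12], 14, 20, 20136100440069584718530617633⟩]
  .leaf) 80142715
  [⟨[38, 12, 12, 12, 11], 9, 15, 2324192900774109184⟩]
  (.node .leaf 80401475
  [⟨[36, 28, 19, 12], 11, 17, 151706036811680403435824⟩] .leaf))) 81125376
  [⟨[36, 28, 20, 12], 10, 16, 151706036773128775926064⟩, ⟨[36, 28, 20, 12], 12, 18, 231989937415471610462512⟩]
  (.node (.node (.node (.node .leaf 81650353
  [⟨[38, 17, 12, 12, 12, 12], 13, 19, 383992049852954488877104⟩] .leaf) 81821332
  [⟨[36, 28, 19, 17, 12], 14, 20, 14874850548434431287666684160⟩]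
  .leaf) 82435168
  [⟨[38, 20], 6, 10, 36284421636128⟩]
  (.node .leaf 82457452
  [⟨[36, 28, 20, 17, 11], 14, 20, 25474797139722499533080363009⟩] .leaf)) 82743049
  [⟨[38, 20, 12, 9], 11, 23, 2319671704664670208⟩]
  (.node (.node .leaf 84264908
  [⟨[38, 20, 17, 12, 11], 12, 18, 378971077000489086222336⟩] .leaf) 84570817
  [⟨[34, 33], 11, 19, 1229765277341778177⟩]
  (.node .leaf 85357473
  [⟨[34, 33, 14, 12], 9, 15, 241432139393399858925568⟩] .leaf))))

def responseTableRLLR : Table :=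
  .node (.node (.node (.node (.node (.node .leaf 90642169
  [⟨[36, 28, 25, 20], 13, 19, 14913384468647805813085306944⟩] .leaf) 90870848
  [⟨[34, 34], 12, 20, 1229765277341778177⟩]
  .leaf) 93753694
  [⟨[38, 26, 19, 11], 10, 16, 152023158075141603196976⟩]
  (.node .leaf 93869482
  [⟨[38, 25, 20, 17, 12], 14, 20, 24778380625729092679692713984⟩] .leaf)) 95261332
  [⟨[38, 26, 19, 17, 12], 14, 20, 25107350118433813990296518656⟩]
  (.node (.node (.node .leaf 105541414
  [⟨[35, 35, 12, 12], 10, 16, 232007231556001221124400⟩] .leaf) 106311483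
  [⟨[36, 34, 12, 11], 11, 17, 317285151006901351219504⟩]
  .leaf) 114905572
  [⟨[36, 35, 17, 12, 12], 14, 20, 19865220815440565035044184353⟩]
  (.node .leaf 115956201
  [⟨[41, 10], 7, 11, 36352889520642⟩] .leaf))) 116017252
  [⟨[41, 11], 8, 10, 37465301782529⟩]
  (.node (.node (.node (.node .leaf 116105033
  [⟨[41, 12], 7, 11, 35265976471552⟩] .leaf) 116394025
  [⟨[41, 14], 7, 11, 37452416880641⟩]
  .leaf) 116701906
  [⟨[41, 14, 12, 9], 8, 14, 4629735876455301121⟩]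
  (.node .leaf 117376058
  [⟨[41, 17, 10], 12, 20, 2314850345908503042⟩] .leaf)) 119156201
  [⟨[41, 20, 10], 11, 21, 2310381934947074049⟩]
  (.node (.node .leaf 119305033
  [⟨[41, 20, 12], 11, 21, 2382441659590844673⟩] .leaf) 119901906
  [⟨[41, 20, 14, 12, 9], 10, 16, 378677077476862108700673⟩]
  (.node .leaf 120724890
  [⟨[41, 20, 17, 12], 10, 16, 307842732927723130322993⟩] .leaf)))) 121570561
  [⟨[38, 33, 20], 13, 25, 76445694350358963294208⟩]
  (.node (.node (.node (.node (.node .leaf 125621826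
  [⟨[41, 25], 6, 12, 1157464768828670466⟩] .leaf) 130205108
  [⟨[41, 27], 10, 18, 1152958969606636032⟩]
  .leaf) 130991764
  [⟨[41, 27, 14, 12], 10, 16, 232007303859817091694593⟩]
  (.node .leaf 132272140
  [⟨[42, 17, 11], 8, 14, 3467806966166847488⟩] .leaf)) 133066569
  [⟨[41, 28], 7, 13, 2377900672257360386⟩]
  (.node (.node (.node .leaf 133476452
  [⟨[41, 28, 12, 11], 14, 26, 302859801697842559459840⟩] .leaf) 134140064
  [⟨[42, 20, 12], 12, 22, 3612487307816411393⟩]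
  .leaf) 147067492
  [⟨[43, 9], 6, 10, 35322080526336⟩]
  (.node .leaf 147108443
  [⟨[43, 10], 7, 13, 35253360001024⟩] .leaf))) 147169494
  [⟨[43, 11], 6, 10, 36356898160896⟩, ⟨[43, 11], 8, 12, 35253091569667⟩]
  (.node (.node (.node (.node .leaf 147257275
  [⟨[43, 12], 7, 11, 36352603197443⟩] .leaf) 150308443
  [⟨[43, 20, 10], 11, 21, 2310386264542609953⟩]
  .leaf) 151877132
  [⟨[43, 20, 17, 12], 10, 16, 317323207007666589138944⟩]
  (.node .leaf 155240426
  [⟨[41, 33, 12], 14, 24, 161150765798157455524352⟩] .leaf)) 156774068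
  [⟨[43, 25], 10, 18, 1224979167364252192⟩]
  (.node (.node .leaf 158470336
  [⟨[38, 38], 8, 12, 1162246462992621824⟩] .leaf) 161357350
  [⟨[43, 27], 6, 12, 2315413296148185090⟩]
  (.node .leaf 164975273
  [⟨[44, 9], 7, 11, 38620882804739⟩] .leaf))))

def responseTableRLL : Table :=
  .node responseTableRLLL 87055025
  [⟨[38, 20, 20, 17], 11, 17, 308156404120646409256961⟩] responseTableRLLR

def responseTableRLRL : Table :=
  .node (.node (.node (.node (.node (.node .leaf 165165056
  [⟨[44, 12], 8, 12, 35253091569667⟩] .leaf) 165454048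
  [⟨[44, 14], 6, 10, 35257656016896⟩]
  .leaf) 167492323
  [⟨[44, 19, 10], 11, 21, 2315171335136940065⟩]
  (.node .leaf 168175273
  [⟨[44, 20, 9], 11, 21, 2310386264543596577⟩] .leaf)) 168216224
  [⟨[44, 20, 10], 12, 22, 2315171339147677729⟩]
  (.node (.node (.node .leaf 168365056
  [⟨[44, 20, 12], 8, 14, 2314850281752363265⟩] .leaf) 168478076
  [⟨[41, 35, 10], 14, 24, 160855612828683381973760⟩]
  .leaf) 168654048
  [⟨[44, 20, 14], 8, 12, 2314850281751322624⟩]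
  (.node .leaf 169784913
  [⟨[44, 20, 17, 12], 11, 17, 302530070634499075473920⟩] .leaf))) 170651372
  [⟨[44, 20, 19, 9], 14, 26, 156133246397426625941537⟩]
  (.node (.node (.node (.node .leaf 170753374
  [⟨[44, 20, 19, 11], 10, 16, 152058827147071073550640⟩] .leaf) 170841155
  [⟨[44, 20, 19, 12], 11, 17, 152001181071840732262705⟩]
  .leaf) 171308443
  [⟨[43, 30], 9, 19, 1161928841568985091⟩]
  (.node .leaf 171565056
  [⟨[44, 20, 20, 12], 10, 16, 152001180174639242944769⟩] .leaf)) 171826908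
  [⟨[41, 35, 20, 12], 12, 18, 15514377327974960606788714544⟩]
  (.node (.node .leaf 174681849
  [⟨[44, 25], 9, 19, 1152921573326327811⟩] .leaf) 176101706
  [⟨[44, 25, 17], 14, 24, 151119186269192309444640⟩]
  (.node .leaf 177881849
  [⟨[44, 25, 20], 11, 17, 246155874935444868182019⟩] .leaf)))) 179265131
  [⟨[44, 27], 9, 13, 2522015929051652099⟩]
  (.node (.node (.node (.node (.node .leaf 182126592
  [⟨[44, 28], 8, 12, 2305843146937860096⟩] .leaf) 183546449
  [⟨[44, 28, 17], 13, 25, 245564214587175627395120⟩]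
  .leaf) 183956332
  [⟨[44, 28, 17, 12, 11], 14, 20, 25458845317781135280992944129⟩]
  (.node .leaf 184602691
  [⟨[44, 28, 19], 13, 25, 76186210450697477951537⟩] .leaf)) 185326592
  [⟨[44, 28, 20], 14, 26, 76518251844024249880625⟩]
  (.node (.node (.node .leaf 186243836
  [⟨[43, 33, 10], 14, 24, 165614878426932504956931⟩] .leaf) 189216224
  [⟨[44, 30], 10, 20, 1152921642314244098⟩]
  .leaf) 203354204
  [⟨[43, 33, 28], 16, 28, 4971108284152798045503754290⟩]
  (.node .leaf 204110666
  [⟨[44, 33, 9], 14, 24, 245895098784096583684129⟩] .leaf))) 204589441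
  [⟨[44, 33, 14], 13, 25, 246451973152918398304560⟩]
  (.node (.node (.node (.node .leaf 206062976
  [⟨[46, 10], 8, 12, 35253360001024⟩] .leaf) 206211808
  [⟨[46, 12], 6, 10, 35253091565568⟩]
  .leaf) 207500449
  [⟨[44, 33, 20, 12], 13, 19, 15846751349536325082312352547⟩]
  (.node .leaf 209411808
  [⟨[46, 20, 12], 8, 14, 2315413231706832897⟩] .leaf)) 210600480
  [⟨[44, 34, 12], 10, 16, 241135843035204170023171⟩]
  (.node (.node .leaf 210831665
  [⟨[46, 20, 17, 12], 11, 17, 307252581741626386284544⟩] .leaf) 212988798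
  [⟨[44, 34, 19, 11], 12, 18, 9942357351390571013694554416⟩]
  (.node .leaf 254803968
  [⟨[48], 4, 10, 17592186109952⟩] .leaf))))

def responseTableRLRR : Table :=
  .node (.node (.node (.node (.node (.node .leaf 282475249
  [⟨[49], 5, 9, 20890721976320⟩] .leaf) 283261905
  [⟨[49, 14, 12], 7, 13, 3612186037301805314⟩]
  .leaf) 284681762
  [⟨[49, 17, 14, 12], 12, 18, 326768002442085458313216⟩]
  (.node .leaf 285151473
  [⟨[49, 18, 14, 12], 11, 17, 312655018297451956142594⟩] .leaf)) 285983130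
  [⟨[49, 20, 12, 9], 10, 16, 227598594530069029326880⟩]
  (.node (.node (.node .leaf 286172913
  [⟨[49, 20, 12, 12], 11, 17, 312600975053476547534850⟩] .leaf) 287095106
  [⟨[49, 20, 17], 12, 18, 232376310551357228646400⟩]
  .leaf) 287881762
  [⟨[49, 20, 17, 14, 12], 14, 20, 19903991406286048273390174464⟩]
  (.node .leaf 288415537
  [⟨[49, 22, 14, 12], 11, 17, 227265039980250173407746⟩] .leaf))) 288875249
  [⟨[49, 20, 20], 9, 15, 152041533025499501167106⟩, ⟨[49, 20, 20], 13, 25, 76444469392146476040194⟩]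
  (.node (.node (.node (.node .leaf 291136762
  [⟨[49, 22, 20, 12, 9], 14, 20, 14913686701237669421215911984⟩] .leaf) 292489706
  [⟨[49, 25, 12], 14, 24, 231988785655046199189505⟩]
  .leaf) 295607456
  [⟨[44, 42], 14, 24, 80944395187303507567138⟩]
  (.node .leaf 295689706
  [⟨[49, 25, 20, 12], 14, 20, 15513168140441898427355377666⟩] .leaf)) 295978698
  [⟨[49, 25, 20, 14], 12, 18, 15538475305891931518513840130⟩]
  (.node (.node .leaf 299934449
  [⟨[49, 28, 12], 13, 25, 160856770273442189550082⟩] .leaf) 300272988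
  [⟨[49, 27, 20, 12], 12, 18, 14919505544494088323919314992⟩]
  (.node .leaf 313286656
  [⟨[50, 14, 12], 8, 14, 3612185968330735872⟩] .leaf)))) 314329740
  [⟨[50, 17, 12, 11], 10, 16, 307841652308934666485760⟩]
  (.node (.node (.node (.node (.node .leaf 314706513
  [⟨[50, 17, 14, 12], 11, 17, 312599687300853086158848⟩] .leaf) 315762755
  [⟨[50, 19, 14, 12], 11, 17, 227598378360598618505987⟩]
  .leaf) 317182612
  [⟨[50, 19, 17, 14, 12], 14, 20, 19886906196864814620178711299⟩]
  (.node .leaf 319483372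
  [⟨[50, 22, 17, 12, 11], 14, 20, 25126546554318256162518077440⟩] .leaf)) 329832448
  [⟨[44, 44], 12, 24, 75557868230682181898241⟩]
  (.node (.node (.node .leaf 345025251
  [⟨[51], 5, 9, 17665201537281⟩, ⟨[51], 7, 13, 17592187092992⟩] .leaf) 345374083
  [⟨[51, 12, 10], 11, 21, 2315995968320966660⟩]
  .leaf) 348533132
  [⟨[51, 20, 12, 9], 14, 26, 232282563622613666566148⟩]
  (.node .leaf 351425251
  [⟨[51, 20, 20], 13, 25, 76167769635186171514884⟩] .leaf))) 354890876
  [⟨[51, 25, 10], 14, 24, 227263887005762850918404⟩]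
  (.node (.node (.node (.node .leaf 362484451
  [⟨[51, 28, 12], 13, 25, 156134395062794738208772⟩] .leaf) 372001244
  [⟨[51, 28, 25], 16, 28, 14855280767725689196209377314⟩]
  .leaf) 380204032
  [⟨[52], 6, 10, 17592187092992⟩]
  (.node .leaf 380363081
  [⟨[52, 10, 9], 11, 21, 3756021949427355652⟩] .leaf)) 380465083
  [⟨[52, 11, 10], 11, 21, 2315995968574590980⟩]
  (.node (.node .leaf 380511913
  [⟨[52, 12, 9], 11, 21, 2315995968574590980⟩] .leaf) 380552864
  [⟨[52, 12, 10], 12, 22, 2315995968574590980⟩]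
  (.node .leaf 380613915
  [⟨[52, 12, 11], 7, 13, 2314870072960614401⟩] .leaf))))

def responseTableRLR : Table :=
  .node responseTableRLRL 280772425
  [⟨[44, 41], 13, 23, 80612344223827527467554⟩] responseTableRLRR

def responseTableRL : Table :=
  .node responseTableRLL 165077275
  [⟨[44, 11], 7, 11, 35257387581955⟩] responseTableRLR

def responseTableRRLL : Table :=
  .node (.node (.node (.node (.node (.node .leaf 382121553
  [⟨[52, 17, 12, 12], 11, 17, 152057677851751523287073⟩] .leaf) 382322764
  [⟨[52, 17, 14, 11], 10, 16, 317378762831027909952033⟩]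
  .leaf) 382988012
  [⟨[52, 19, 12, 9], 14, 26, 231987406412336127348769⟩]
  (.node .leaf 383043746
  [⟨[52, 17, 17], 14, 24, 151709495556260741779460⟩] .leaf)) 383404032
  [⟨[52, 20], 8, 12, 2305878193873092640⟩]
  (.node (.node (.node .leaf 383813915
  [⟨[52, 20, 12, 11], 11, 17, 152298841108128865452096⟩] .leaf) 384000905
  [⟨[52, 20, 14, 9], 11, 17, 303158413663746085953794⟩]
  .leaf) 384099988
  [⟨[52, 19, 17], 10, 16, 151708545297843174252593⟩]
  (.node .leaf 384823889
  [⟨[52, 20, 17], 9, 15, 76150753629522888753664⟩, ⟨[52, 20, 17], 13, 25, 155839260384662956019760⟩] .leaf))) 385233772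
  [⟨[52, 20, 17, 12, 11], 14, 20, 25474561355754618277740937216⟩]
  (.node (.node (.node (.node .leaf 385880131
  [⟨[52, 20, 19], 13, 25, 76167773012885890928673⟩] .leaf) 386604032
  [⟨[52, 20, 20], 10, 16, 226675897056009857794563⟩, ⟨[52, 20, 20], 14, 26, 76167769635186170400772⟩]
  .leaf) 387299988
  [⟨[52, 20, 19, 17], 12, 18, 19884652724234082673294835715⟩]
  (.node .leaf 387360644
  [⟨[51, 33, 20], 16, 28, 14919504655663701944075096113⟩] .leaf)) 388023889
  [⟨[52, 20, 20, 17], 13, 19, 4990687548928640395765613315⟩]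
  (.node (.node .leaf 390028706
  [⟨[52, 25, 9], 14, 24, 156151688602712041066500⟩] .leaf) 391927338
  [⟨[52, 25, 17, 14], 12, 18, 10271194970705142609359155505⟩]
  (.node .leaf 397575451
  [⟨[52, 28, 11], 13, 25, 156134395062794738208802⟩] .leaf)))) 397663232
  [⟨[52, 28, 12], 14, 26, 156134395062794738208772⟩]
  (.node (.node (.node (.node (.node .leaf 419339425
  [⟨[52, 33], 13, 23, 80593897215866732285956⟩] .leaf) 421815524
  [⟨[52, 33, 19], 16, 28, 4951986830804775197291319345⟩]
  .leaf) 425639456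
  [⟨[52, 34], 14, 24, 80593897215866732285956⟩]
  (.node .leaf 429732524
  [⟨[49, 43, 12], 12, 18, 10852527085347538971207541506⟩] .leaf)) 433223571
  [⟨[52, 35, 12, 12], 13, 19, 15515429824252207818531275040⟩]
  (.node (.node (.node .leaf 459165024
  [⟨[54], 4, 8, 17665201537280⟩, ⟨[54], 8, 12, 17592187092992⟩] .leaf) 461130284
  [⟨[51, 41, 12], 16, 28, 10854944955432648074278735876⟩]
  .leaf) 461949004
  [⟨[54, 19, 12, 9], 10, 16, 227266346536312682643714⟩]
  (.node .leaf 462585124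
  [⟨[54, 20, 11, 9], 10, 16, 227582102912287371231489⟩] .leaf))) 466260980
  [⟨[54, 20, 19, 17], 14, 20, 19847167482921034492988620801⟩]
  (.node (.node (.node (.node .leaf 601792057
  [⟨[57, 10], 11, 19, 2527667285423883268⟩] .leaf) 601853108
  [⟨[57, 11], 10, 18, 2603080584653901824⟩]
  .leaf) 601940889
  [⟨[57, 12], 9, 13, 2526541463094824992⟩]
  (.node .leaf 603360746
  [⟨[57, 17, 12], 14, 24, 151779819245681479188482⟩] .leaf)) 606560746
  [⟨[57, 20, 17, 12], 14, 20, 21702788019750151685570494720⟩]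
  (.node (.node .leaf 618902425
  [⟨[57, 28], 13, 23, 75853089355574973367300⟩] .leaf) 627411914
  [⟨[57, 30, 17], 16, 28, 16131982580254060359452917763⟩]
  (.node .leaf 654462764
  [⟨[57, 35, 12], 12, 18, 15804453113026406768627942147⟩] .leaf))))

def responseTableRRLR : Table :=
  .node (.node (.node (.node (.node (.node .leaf 656456768
  [⟨[58, 10], 12, 20, 2527667285423883268⟩] .leaf) 656517819
  [⟨[58, 11], 7, 13, 2526519463986135296⟩]
  .leaf) 656894592
  [⟨[58, 14], 8, 14, 2526519390954848256⟩]
  (.node .leaf 658025457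
  [⟨[58, 17, 12], 11, 17, 241489790817822721450243⟩] .leaf)) 658724332
  [⟨[58, 17, 14, 12, 11], 14, 20, 25768632282580559552753705280⟩]
  (.node (.node (.node .leaf 660094592
  [⟨[58, 20, 14], 8, 14, 241488637015540599095296⟩, ⟨[58, 20, 14], 10, 16, 241486331172531384483840⟩] .leaf) 662679281
  [⟨[52, 49], 11, 17, 11185132798946698955552260611⟩, ⟨[52, 49], 15, 27, 6189700196427483085135679520⟩]
  .leaf) 696029985
  [⟨[58, 33, 14], 11, 17, 15803078904303894488951030788⟩]
  (.node .leaf 715024299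
  [⟨[59, 10], 9, 19, 2314850213031969284⟩] .leaf))) 715085350
  [⟨[59, 11], 6, 12, 2314867873685832192⟩]
  (.node (.node (.node (.node .leaf 715173131
  [⟨[59, 12], 7, 13, 2314850208468434944⟩, ⟨[59, 12], 9, 19, 2310346608841064448⟩] .leaf) 716444156
  [⟨[59, 17, 10], 14, 24, 151706032269455595147269⟩]
  .leaf) 716592988
  [⟨[59, 17, 12], 10, 16, 226971050010146334834736⟩]
  (.node .leaf 717548258
  [⟨[57, 41], 16, 26, 11141540670701126751066588160⟩] .leaf)) 718373131
  [⟨[59, 20, 12], 9, 15, 151779819265546208149504⟩, ⟨[59, 20, 12], 13, 25, 156135696882221550080005⟩]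
  (.node (.node .leaf 719792988
  [⟨[59, 20, 17, 12], 12, 18, 14874775064357661811745554432⟩] .leaf) 725229283
  [⟨[52, 51], 15, 27, 5280663575987980462059425829⟩]
  (.node .leaf 727889924
  [⟨[59, 25, 20], 16, 28, 15539683601067741459004854321⟩] .leaf)))) 733554524
  [⟨[59, 28, 17], 16, 28, 14913384763854275447690887202⟩]
  (.node (.node (.node (.node (.node .leaf 748700500
  [⟨[57, 43], 14, 26, 4971103634347747154086526977⟩] .leaf) 754308524
  [⟨[59, 33, 12], 16, 28, 10561176587347220236924555269⟩]
  .leaf) 777659049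
  [⟨[60, 9], 9, 19, 2310366473333248004⟩]
  (.node .leaf 777700000
  [⟨[60, 10], 10, 20, 2314850281751314692⟩] .leaf)) 777848832
  [⟨[60, 12], 8, 12, 2314850281482878976⟩, ⟨[60, 12], 6, 12, 2314850281482878976⟩]
  (.node (.node (.node .leaf 778445705
  [⟨[60, 14, 12, 9], 11, 17, 322027338396948748108547⟩] .leaf) 779268689
  [⟨[60, 17, 12], 9, 15, 226971054234470008750083⟩]
  .leaf) 779678572
  [⟨[60, 17, 12, 12, 11], 14, 20, 9984759483499321134756667728⟩]
  (.node .leaf 780324931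
  [⟨[60, 19, 12], 13, 25, 156135696882285689376801⟩] .leaf))) 780859049
  [⟨[60, 20, 9], 11, 17, 151726996824792480350722⟩]
  (.node (.node (.node (.node .leaf 780961051
  [⟨[60, 20, 11], 9, 15, 151783278030060028691248⟩, ⟨[60, 20, 11], 13, 25, 156467738294304158978081⟩] .leaf) 781048832
  [⟨[60, 20, 12], 8, 14, 151779819265546208149504⟩, ⟨[60, 20, 12], 10, 16, 151779819245754996752385⟩, ⟨[60, 20, 12], 14, 26, 156135696882285689376773⟩]
  .leaf) 781744788
  [⟨[60, 19, 17, 12], 12, 18, 14894212324805939446094496515⟩]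
  (.node .leaf 782380908
  [⟨[60, 20, 17, 11], 12, 18, 10232499845777310279236845632⟩] .leaf)) 782468689
  [⟨[60, 20, 17, 12], 13, 19, 10232348801310015260526116866⟩]
  (.node (.node .leaf 789841724
  [⟨[60, 25, 19], 16, 28, 15534923455644246848699568177⟩] .leaf) 793368764
  [⟨[60, 27, 17], 16, 28, 9942433243746228989923102754⟩]
  (.node .leaf 879840523
  [⟨[59, 44], 11, 17, 5280664202177218171451212547⟩, ⟨[59, 44], 15, 27, 5280664167584204113420944389⟩] .leaf))))

def responseTableRRL : Table :=
  .node responseTableRRLL 656415817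
  [⟨[58, 9], 11, 19, 2527667285423883268⟩] responseTableRRLR

def responseTableRRRL : Table :=
  .node (.node (.node (.node (.node (.node .leaf 916381664
  [⟨[62, 12], 10, 20, 2310346608841064448⟩] .leaf) 919581664
  [⟨[62, 20, 12], 10, 16, 227303090840523673501696⟩]
  .leaf) 927318314
  [⟨[62, 25, 17], 16, 28, 9942357056242683421963321344⟩]
  (.node .leaf 942516224
  [⟨[60, 44], 16, 28, 5280664167584204113656680453⟩] .leaf)) 997648380
  [⟨[59, 49, 12], 14, 20, 976413796154493351458796862505475⟩]
  (.node (.node (.node .leaf 1073741824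
  [⟨[64], 6, 12, 1152921508935630848⟩] .leaf) 1160290625
  [⟨[65], 9, 17, 1297036774288195584⟩]
  .leaf) 1160551676
  [⟨[65, 11, 10], 14, 24, 151708329140518914367488⟩]
  (.node .leaf 1160598506
  [⟨[65, 12, 9], 14, 24, 151707320300117036368128⟩] .leaf))) 1165966724
  [⟨[65, 20, 19], 16, 28, 4991731174401755143569944832⟩]
  (.node (.node (.node (.node .leaf 1177662044
  [⟨[65, 28, 11], 16, 28, 10541908724647126067676513536⟩] .leaf) 1199426018
  [⟨[65, 33], 16, 26, 5591286657827924677458199808⟩]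
  .leaf) 1252332576
  [⟨[66], 8, 12, 1152921573327372288⟩]
  (.node .leaf 1253119232
  [⟨[66, 14, 12], 10, 16, 227560480566353600708612⟩] .leaf)) 1253752433
  [⟨[66, 17], 9, 15, 76149312475369838740224⟩]
  (.node (.node .leaf 1316616356
  [⟨[59, 57], 18, 30, 770742089861189937647254415347717⟩] .leaf) 1350125107
  [⟨[67], 9, 17, 1152939165563749634⟩]
  (.node .leaf 1453933568
  [⟨[68], 8, 14, 1152922672872558594⟩, ⟨[68], 10, 18, 1152922672872558594⟩] .leaf)))) 1457441449
  [⟨[68, 20, 12, 9], 13, 19, 19865221368843430478106079280⟩]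
  (.node (.node (.node (.node (.node .leaf 1505315876
  [⟨[65, 51], 18, 30, 325791158512297693521069939623168⟩] .leaf) 1680700000
  [⟨[70], 8, 12, 1152921504876331008⟩]
  .leaf) 1681048832
  [⟨[70, 12, 10], 14, 26, 151707176218945053003776⟩]
  (.node .leaf 1719835393
  [⟨[70, 33], 15, 27, 5300081946968916974666514432⟩] .leaf)) 2073171593
  [⟨[73, 10], 13, 23, 151540002565523966525440⟩]
  (.node (.node (.node .leaf 2073320425
  [⟨[73, 12], 9, 15, 151410875357007999668224⟩, ⟨[73, 12], 13, 23, 156152985904330989437441⟩] .leaf) 2074740282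
  [⟨[73, 17, 12], 12, 18, 14874784140146720112874881024⟩]
  .leaf) 2076520425
  [⟨[73, 20, 12], 11, 17, 9947041938941577628462613504⟩]
  (.node .leaf 2082837218
  [⟨[73, 25], 16, 26, 5261245758555997031451657729⟩] .leaf))) 2125842300
  [⟨[73, 35, 12], 14, 20, 690880140728252741944700169224197⟩]
  (.node (.node (.node (.node .leaf 2219167675
  [⟨[74, 11], 13, 23, 156152985904331225104897⟩] .leaf) 2219255456
  [⟨[74, 12], 8, 14, 151410879860607627035648⟩, ⟨[74, 12], 10, 16, 151410880177271807741952⟩, ⟨[74, 12], 14, 24, 156152985924122198737409⟩]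
  .leaf) 2222455456
  [⟨[74, 20, 12], 12, 18, 9942206235672143903207723008⟩]
  (.node .leaf 2373146875
  [⟨[75, 10], 13, 23, 151412032784380246102023⟩] .leaf)) 2373295707
  [⟨[75, 12], 11, 23, 151410880425761435553793⟩]
  (.node (.node .leaf 2382812500
  [⟨[75, 25], 14, 26, 5261245518609027975627145729⟩] .leaf) 2386012500
  [⟨[75, 25, 20], 14, 20, 1018409364713080004965475063694854⟩]
  (.node .leaf 2390257243
  [⟨[75, 28], 15, 27, 4971108007373930054810599943⟩] .leaf))))

def responseTableRRRR : Table :=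
  .node (.node (.node (.node (.node (.node .leaf 2535625376
  [⟨[76, 10], 14, 24, 151412032784380246102023⟩] .leaf) 2535686427
  [⟨[76, 11], 9, 15, 151429326904921076793348⟩, ⟨[76, 11], 11, 23, 151706028348541564355073⟩]
  .leaf) 2535774208
  [⟨[76, 12], 10, 16, 151412032799773407839776⟩, ⟨[76, 12], 12, 24, 151410880443362211532801⟩]
  (.node .leaf 2536063200
  [⟨[76, 14], 10, 14, 189228002267169871101954⟩] .leaf)) 2537194065
  [⟨[76, 17, 12], 13, 19, 17041188654786544098648000007⟩]
  (.node (.node (.node .leaf 2538974208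
  [⟨[76, 20, 12], 12, 18, 9961549048776970839734095904⟩] .leaf) 2552735744
  [⟨[76, 28], 16, 28, 4971108007373930054508610082⟩]
  .leaf) 2887423200
  [⟨[78, 12], 10, 14, 156134538877807279211008⟩]
  (.node .leaf 3276800000
  [⟨[80], 8, 14, 85408429585778458232322⟩] .leaf))) 3488204258
  [⟨[81, 17], 16, 26, 9942357057535765120084412162⟩]
  (.node (.node (.node (.node .leaf 3501382140
  [⟨[81, 27, 12], 14, 20, 1097795988378575058099604186857478⟩] .leaf) 3939040643
  [⟨[83], 11, 21, 75557868247106137886720⟩]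
  .leaf) 3942240643
  [⟨[83, 20], 11, 17, 9942286515893611578860241153⟩, ⟨[83, 20], 15, 27, 5001406692286081339252281377⟩]
  (.node .leaf 3943660500
  [⟨[83, 20, 17], 14, 20, 328490832525686454247619828909575⟩] .leaf)) 3978176036
  [⟨[83, 33], 18, 30, 649049796277815145942159815872520⟩]
  (.node (.node .leaf 4182119424
  [⟨[84], 10, 14, 80281387636156215067144⟩] .leaf) 4183539281
  [⟨[84, 17], 11, 17, 4990526359905028540701083143⟩, ⟨[84, 17], 15, 27, 12688970996725110187631841312⟩]
  (.node .leaf 4184595523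
  [⟨[84, 19], 11, 17, 9903671763281670293111703072⟩, ⟨[84, 19], 15, 27, 5001406692281277624490135585⟩] .leaf)))) 4185319424
  [⟨[84, 20], 16, 28, 5001406692281296316187807777⟩]
  (.node (.node (.node (.node (.node .leaf 4186015380
  [⟨[84, 19, 17], 14, 20, 328648321710059286434392279352864⟩] .leaf) 4704270176
  [⟨[86], 12, 22, 75557868247106137886720⟩]
  .leaf) 6240570283
  [⟨[91, 12], 15, 27, 10232423990374829702569725961⟩]
  (.node .leaf 6250087076
  [⟨[91, 25], 18, 30, 649037146078332846005587814649865⟩] .leaf)) 6590976283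
  [⟨[92, 11], 11, 17, 9925366278294759628848963616⟩, ⟨[92, 11], 15, 27, 10232423991383636019101306889⟩]
  (.node (.node (.node .leaf 6591064064
  [⟨[92, 12], 16, 28, 10232423714682474913458032649⟩] .leaf) 6592396140
  [⟨[92, 17, 11], 14, 20, 974833236937064054034865630611248⟩]
  .leaf) 8153726976
  [⟨[96], 10, 16, 4971188378825397022752899072⟩]
  (.node .leaf 8587340257
  [⟨[97], 15, 25, 5291473073011371013609425153⟩] .leaf))) 8590540257
  [⟨[97, 20], 13, 19, 732947507230349739799349515386889⟩]
  (.node (.node (.node (.node .leaf 9039207968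
  [⟨[98], 14, 26, 5291473073011371013793974529⟩] .leaf) 9509900499
  [⟨[99], 13, 25, 4951840474414137002576315393⟩]
  .leaf) 9511320356
  [⟨[99, 17], 18, 30, 649042059152863824034848359583754⟩]
  (.node .leaf 10000000000
  [⟨[100], 14, 26, 4951840455967111509724631041⟩] .leaf)) 17623416832
  [⟨[112], 12, 18, 366355975335135700539497303244802⟩]
  (.node (.node .leaf 18424351793
  [⟨[113], 17, 29, 567907468902320560535702094217216⟩] .leaf) 20113571875
  [⟨[115], 17, 29, 325791158512296545079985240543244⟩]
  (.node .leaf 34359738368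
  [⟨[128], 14, 20, 37312212376475920110098942730273161740⟩, ⟨[128], 20, 32, 39877407940406107956734630838431125518⟩] .leaf))))

def responseTableRRR : Table :=
  .node responseTableRRRL 2535584425
  [⟨[76, 9], 13, 23, 151412032799773408890887⟩] responseTableRRRR

def responseTableRR : Table :=
  .node responseTableRRL 916293883
  [⟨[62, 11], 9, 13, 2310365373570023680⟩] responseTableRRR

def responseTableR : Table :=
  .node responseTableRL 381623889
  [⟨[52, 17], 7, 13, 1161947464547238177⟩] responseTableRR

/-- Groups of segments together with replies of the responder to every move of the opponent. -/
def responseTable : Table :=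
  .node responseTableL 61252832
  [⟨[36, 14, 12], 8, 12, 35334964383776⟩] responseTableR

theorem responseTable_all : responseTable.all (entryOK responseTable) = true := by
  decide +kernel

theorem exists_good_even {m : ℕ} (hm : 2 ≤ m) (hm' : m ≤ 16) (h2 : Even m) :
    ∃ a b, Good responseTable {8 * m} a b ∧ m - 2 ≤ a ∧ b ≤ m + 4 := by
  have key : ∀ k ∈ List.range 8, splits responseTable (2 * (k + 1) - 2) (2 * (k + 1) + 4) 8
      [8 * (2 * (k + 1))] 0 0 = true := by decide +kernel
  obtain ⟨r, rfl⟩ := h2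
  obtain ⟨a, b, hg, ha, hb⟩ := good_of_splits (key (r - 1) (by simp; omega))
  rw [show 2 * (r - 1 + 1) = r + r by omega, Multiset.coe_singleton] at hg
  exact ⟨a, b, hg, by omega, by omega⟩

theorem exists_good_sixteen :
    ∃ a b, Good responseTable {8 * 16} a b ∧ 20 ≤ a ∧ b ≤ 32 := by
  have key : splits responseTable 20 32 8 [8 * 16] 0 0 = true := by decide +kernel
  simpa using good_of_splits key

theorem exists_good_two : ∃ a b, Good responseTable {8 * 2} a b ∧ 4 ≤ a ∧ b ≤ 4 := by
  have key : splits responseTable 4 4 8 [8 * 2] 0 0 = true := by decide +kernel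
  simpa using good_of_splits key

/-- The codes of the sides of a segment. -/
def IsSide (l : ℕ) : Prop := l = 0 ∨ l = 1 ∨ l = 3

theorem sides_eq {l r k : ℕ} (hl : IsSide l) (hr : IsSide r) :
    (sideLo (8 * k + (l + r)) = l ∧ sideHi (8 * k + (l + r)) = r) ∨
      (sideLo (8 * k + (l + r)) = r ∧ sideHi (8 * k + (l + r)) = l) := by
  obtain rfl | rfl | rfl := hl <;> obtain rfl | rfl | rfl := hr <;>
    simp [sideLo, sideHi]

theorem segMove_cons {σ l r p q : ℕ} (hl : IsSide l) (hr : IsSide r) (M : Multiset ℕ) :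
    SegMove σ ((8 * (p + q + 1) + (l + r)) ::ₘ M)
      ((8 * p + (l + σ)) ::ₘ (8 * q + (σ + r)) ::ₘ M) := by
  have hlt : l + r < 8 := by
    obtain rfl | rfl | rfl := hl <;> obtain rfl | rfl | rfl := hr <;> norm_num
  have hd : (8 * (p + q + 1) + (l + r)) / 8 = p + q + 1 := by omega
  obtain ⟨h1, h2⟩ | ⟨h1, h2⟩ := sides_eq (k := p + q + 1) hl hr
  · refine ⟨_, p, M, by omega, rfl, ?_⟩
    rw [cutLeft, cutRight, h1, h2, hd]
    congr 3
    omega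
  · refine ⟨_, q, M, by omega, rfl, ?_⟩
    rw [cutLeft, cutRight, h1, h2, hd, Multiset.cons_swap, add_comm l σ, add_comm σ r,
      show p + q + 1 - 1 - q = p by omega]

theorem exists_cut {σ l r k i : ℕ} (hl : IsSide l) (hr : IsSide r)
    (hi : i < (8 * k + (l + r)) / 8) (M : Multiset ℕ) :
    ∃ p q, p + q + 1 = k ∧
      cutLeft σ (8 * k + (l + r)) i ::ₘ cutRight σ (8 * k + (l + r)) i ::ₘ M =
        (8 * p + (l + σ)) ::ₘ (8 * q + (σ + r)) ::ₘ M := by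
  have hlt : l + r < 8 := by
    obtain rfl | rfl | rfl := hl <;> obtain rfl | rfl | rfl := hr <;> norm_num
  have hd : (8 * k + (l + r)) / 8 = k := by omega
  rw [hd] at hi
  obtain ⟨h1, h2⟩ | ⟨h1, h2⟩ := sides_eq (k := k) hl hr
  · refine ⟨i, k - 1 - i, by omega, ?_⟩
    rw [cutLeft, cutRight, h1, h2, hd]
  · refine ⟨k - 1 - i, i, by omega, ?_⟩
    rw [cutLeft, cutRight, h1, h2, hd, Multiset.cons_swap, add_comm σ l, add_comm r σ]

/-- The segments of the path on the `m` vertices from `i` on, coloured by `f` (`0` means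
unselected), where the path is preceded by `k` unselected vertices and a side `l`. -/
def segs (f : ℕ → ℕ) : ℕ → ℕ → ℕ → ℕ → Multiset ℕ
  | 0, l, k, _ => {8 * k + (l + 0)}
  | m + 1, l, k, i =>
    if f i = 0 then segs f m l (k + 1) (i + 1)
    else (8 * k + (l + f i)) ::ₘ segs f m (f i) 0 (i + 1)

theorem segs_congr {f g : ℕ → ℕ} : ∀ {m l k i : ℕ}, (∀ j, i ≤ j → j < i + m → f j = g j) →
    segs f m l k i = segs g m l k i
  | 0, _, _, _, _ => rfl
  | m + 1, l, k, i, h => by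
    have ih : ∀ l k, segs f m l k (i + 1) = segs g m l k (i + 1) := fun l k =>
      segs_congr fun j h1 h2 => h j (by omega) (by omega)
    simp only [segs, ih, h i le_rfl (by omega)]

theorem segMove_segs_of_lt {f : ℕ → ℕ} (hf : ∀ j, IsSide (f j)) {σ : ℕ} :
    ∀ {m l k q i : ℕ}, IsSide l →
      SegMove σ (segs f m l (k + q + 1) i) ((8 * k + (l + σ)) ::ₘ segs f m σ q i)
  | 0, l, k, q, i, hl => segMove_cons hl (.inl rfl) 0
  | m + 1, l, k, q, i, hl => by
    unfold segs
    split_ifs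
    · exact segMove_segs_of_lt (q := q + 1) hf hl
    · exact segMove_cons hl (hf i) _

theorem segMove_segs_update {f : ℕ → ℕ} (hf : ∀ j, IsSide (f j)) {σ : ℕ} (hσ : σ ≠ 0) {j : ℕ}
    (hj : f j = 0) :
    ∀ {m l k i : ℕ}, IsSide l → i ≤ j → j < i + m →
      SegMove σ (segs f m l k i) (segs (Function.update f j σ) m l k i)
  | 0, _, _, _, _, _, _ => by omega
  | m + 1, l, k, i, hl, h1, h2 => by
    unfold segs
    obtain rfl | hij := eq_or_ne i j
    · rw [if_pos hj, Function.update_self, if_neg hσ,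
        segs_congr (f := Function.update f i σ) (g := f) fun j' h _ =>
          Function.update_of_ne (by omega) _ _]
      exact segMove_segs_of_lt (q := 0) hf hl
    · rw [Function.update_of_ne hij]
      split_ifs
      · exact segMove_segs_update hf hσ hj hl (by omega) (by omega)
      · rw [← Multiset.singleton_add, ← Multiset.singleton_add _ (segs _ _ _ _ _)]
        exact (segMove_segs_update hf hσ hj (hf i) (by omega) (by omega)).add_left _

theorem eq_segs_of_segMove {f : ℕ → ℕ} (hf : ∀ j, IsSide (f j)) {σ : ℕ} (hσ : σ ≠ 0) :
    ∀ {m l k i : ℕ} {N : Multiset ℕ}, IsSide l → SegMove σ (segs f m l k i) N →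
      (∃ p q, p + q + 1 = k ∧ N = (8 * p + (l + σ)) ::ₘ segs f m σ q i) ∨
        ∃ j, i ≤ j ∧ j < i + m ∧ f j = 0 ∧ N = segs (Function.update f j σ) m l k i
  | 0, l, k, i, N, hl, ⟨c, p, M, hp, hM, hN⟩ => by
    obtain ⟨rfl, rfl⟩ | ⟨-, K, hK, -⟩ :=
      Multiset.cons_eq_cons.1 (show (8 * k + (l + 0)) ::ₘ 0 = c ::ₘ M from hM)
    · obtain ⟨p', q, h, hc⟩ := exists_cut (σ := σ) hl (.inl rfl) hp 0
      exact .inl ⟨p', q, h, hN.trans hc⟩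
    · exact absurd hK Multiset.zero_ne_cons
  | m + 1, l, k, i, N, hl, hm => by
    unfold segs at hm
    split_ifs at hm with hi
    · obtain ⟨p, q, h, rfl⟩ | ⟨j, h1, h2, h3, rfl⟩ := eq_segs_of_segMove hf hσ hl hm
      · obtain _ | q := q
        · refine .inr ⟨i, le_rfl, by omega, hi, ?_⟩
          rw [segs, Function.update_self, if_neg hσ,
            segs_congr (f := Function.update f i σ) (g := f) fun j' h _ =>
              Function.update_of_ne (by omega) _ _]
          congr 2
          omega
        · refine .inl ⟨p, q, by omega, ?_⟩
          rw [segs, if_pos hi]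
      · refine .inr ⟨j, by omega, by omega, h3, ?_⟩
        rw [segs, Function.update_of_ne (by omega), if_pos hi]
    · obtain ⟨c, p, M, hp, hM, rfl⟩ := hm
      obtain ⟨rfl, rfl⟩ | ⟨-, K, hK, rfl⟩ := Multiset.cons_eq_cons.1 hM
      · obtain ⟨p', q, h, hc⟩ := exists_cut (σ := σ) hl (hf i) hp (segs f m (f i) 0 (i + 1))
        refine .inl ⟨p', q, h, hc.trans ?_⟩
        rw [segs, if_neg hi]
      · obtain ⟨p', q, h, -⟩ | ⟨j, h1, h2, h3, hN⟩ :=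
          eq_segs_of_segMove hf hσ (hf i) ⟨c, p, K, hp, hK, rfl⟩
        · omega
        · refine .inr ⟨j, by omega, by omega, h3, ?_⟩
          rw [segs, Function.update_of_ne (by omega), if_neg hi, ← hN,
            Multiset.cons_swap _ (8 * k + _), Multiset.cons_swap _ (8 * k + _)]

/-- The segments of consecutive paths with the given numbers of vertices, starting at `i`, with
the edges between different paths left out. -/
def blockSegs (f : ℕ → ℕ) : List ℕ → ℕ → Multiset ℕ
  | [], _ => 0
  | m :: ms, i => segs f m 0 0 i + blockSegs f ms (i + m)

theorem blockSegs_congr {f g : ℕ → ℕ} :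
    ∀ {ms : List ℕ} {i : ℕ}, (∀ j, i ≤ j → j < i + ms.sum → f j = g j) →
      blockSegs f ms i = blockSegs g ms i
  | [], _, _ => rfl
  | m :: ms, i, h => by
    rw [List.sum_cons] at h
    rw [blockSegs, blockSegs, segs_congr fun j h1 h2 => h j h1 (by omega),
      blockSegs_congr fun j h1 h2 => h j (by omega) (by omega)]

theorem segMove_blockSegs_update {f : ℕ → ℕ} (hf : ∀ j, IsSide (f j)) {σ : ℕ} (hσ : σ ≠ 0)
    {j : ℕ} (hj : f j = 0) :
    ∀ {ms : List ℕ} {i : ℕ}, i ≤ j → j < i + ms.sum →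
      SegMove σ (blockSegs f ms i) (blockSegs (Function.update f j σ) ms i)
  | [], i, h1, h2 => by simp at h2; omega
  | m :: ms, i, h1, h2 => by
    rw [List.sum_cons] at h2
    rw [blockSegs, blockSegs]
    obtain h | h := lt_or_ge j (i + m)
    · rw [blockSegs_congr (f := Function.update f j σ) (g := f) fun j' h _ =>
        Function.update_of_ne (by omega) _ _, add_comm, add_comm _ (blockSegs _ _ _)]
      exact (segMove_segs_update hf hσ hj (.inl rfl) h1 h).add_left _
    · rw [segs_congr (f := Function.update f j σ) (g := f) fun j' _ h =>
        Function.update_of_ne (by omega) _ _]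
      exact (segMove_blockSegs_update hf hσ hj h (by omega)).add_left _

theorem segMove_add {σ : ℕ} {A B N : Multiset ℕ} (h : SegMove σ (A + B) N) :
    (∃ A', SegMove σ A A' ∧ N = A' + B) ∨ ∃ B', SegMove σ B B' ∧ N = A + B' := by
  obtain ⟨c, p, M, hp, hM, rfl⟩ := h
  have hc : c ∈ A + B := by simp [hM]
  obtain hc | hc := Multiset.mem_add.1 hc
  · obtain ⟨K, rfl⟩ := Multiset.exists_cons_of_mem hc
    rw [Multiset.cons_add, Multiset.cons_inj_right] at hM
    exact .inl ⟨_, ⟨c, p, K, hp, rfl, rfl⟩, by simp [hM]⟩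
  · obtain ⟨K, rfl⟩ := Multiset.exists_cons_of_mem hc
    rw [Multiset.add_cons, Multiset.cons_inj_right] at hM
    exact .inr ⟨_, ⟨c, p, K, hp, rfl, rfl⟩, by simp [hM]⟩

theorem eq_blockSegs_of_segMove {f : ℕ → ℕ} (hf : ∀ j, IsSide (f j)) {σ : ℕ} (hσ : σ ≠ 0) :
    ∀ {ms : List ℕ} {i : ℕ} {N : Multiset ℕ}, SegMove σ (blockSegs f ms i) N →
      ∃ j, i ≤ j ∧ j < i + ms.sum ∧ f j = 0 ∧ N = blockSegs (Function.update f j σ) ms i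
  | [], i, N, ⟨c, p, M, _, hM, _⟩ => absurd hM Multiset.zero_ne_cons
  | m :: ms, i, N, hN => by
    simp only [List.sum_cons, blockSegs]
    obtain ⟨A, hA, rfl⟩ | ⟨B, hB, rfl⟩ := segMove_add hN
    · obtain ⟨p, q, h, -⟩ | ⟨j, h1, h2, h3, rfl⟩ := eq_segs_of_segMove hf hσ (.inl rfl) hA
      · omega
      · refine ⟨j, h1, by omega, h3, ?_⟩
        rw [blockSegs_congr (f := Function.update f j σ) (g := f) fun j' h _ =>
          Function.update_of_ne (by omega) _ _]
    · obtain ⟨j, h1, h2, h3, rfl⟩ := eq_blockSegs_of_segMove hf hσ hB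
      refine ⟨j, by omega, by omega, h3, ?_⟩
      rw [segs_congr (f := Function.update f j σ) (g := f) fun j' _ h =>
        Function.update_of_ne (by omega) _ _]

/-- The sign of a player, given by its code. -/
def sign (c : ℕ) : ℤ := if c = 1 then 1 else if c = 3 then -1 else 0

theorem abs_sign_le (c : ℕ) : |sign c| ≤ 1 := by
  unfold sign
  split_ifs <;> simp

theorem segWeight_add {l r : ℕ} (hl : IsSide l) (hr : IsSide r) :
    (segWeight (l + r) : ℤ) = 1 - sign l * sign r := by
  obtain rfl | rfl | rfl := hl <;> obtain rfl | rfl | rfl := hr <;> simp [segWeight, sign]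

/-- The sum of the products of signs along the edges of the path on the `m` vertices from `i` on,
preceded by a vertex of sign `p`. -/
def energy (g : ℕ → ℤ) : ℕ → ℤ → ℕ → ℤ
  | 0, _, _ => 0
  | m + 1, p, i => p * g i + energy g m (g i) (i + 1)

theorem segs_of_ne_zero {f : ℕ → ℕ} (hf : ∀ j, IsSide (f j)) :
    ∀ {m l i : ℕ}, IsSide l → (∀ j, i ≤ j → j < i + m → f j ≠ 0) →
      (∀ c ∈ segs f m l 0 i, c < 8) ∧
        (((segs f m l 0 i).map segWeight).sum : ℤ) =
          m + 1 - energy (fun j => sign (f j)) m (sign l) i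
  | 0, l, i, hl, _ => by
    obtain rfl | rfl | rfl := hl <;> simp [segs, segWeight, energy]
  | m + 1, l, i, hl, h => by
    obtain ⟨h1, h2⟩ := segs_of_ne_zero hf (m := m) (i := i + 1) (hf i) fun j h1 h2 =>
      h j (by omega) (by omega)
    rw [segs, if_neg (h i le_rfl (by omega))]
    constructor
    · intro c hc
      obtain rfl | hc := Multiset.mem_cons.1 hc
      · obtain h | h | h := hl <;> obtain h' | h' | h' := hf i <;> omega
      · exact h1 c hc
    · rw [Multiset.map_cons, Multiset.sum_cons, Nat.cast_add, h2, mul_zero, zero_add,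
        segWeight_add hl (hf i), energy]
      push_cast
      ring

theorem exists_energy_add {g : ℕ → ℤ} (hg : ∀ j, |g j| ≤ 1) :
    ∀ (m m' : ℕ) {p : ℤ} (i : ℕ), |p| ≤ 1 → ∃ q, |q| ≤ 1 ∧
      energy g (m + m') p i = energy g m p i + energy g m' q (i + m)
  | 0, m', p, i, hp => ⟨p, hp, by simp [energy]⟩
  | m + 1, m', p, i, hp => by
    obtain ⟨q, hq, h⟩ := exists_energy_add hg m m' (i + 1) (hg i)
    refine ⟨q, hq, ?_⟩
    rw [Nat.add_right_comm, energy, energy, h, add_assoc, add_assoc, add_comm 1 m]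

theorem abs_energy_sub_le {g : ℕ → ℤ} (hg : ∀ j, |g j| ≤ 1) (m : ℕ) {p : ℤ} (i : ℕ)
    (hp : |p| ≤ 1) : |energy g m p i - energy g m 0 i| ≤ 1 := by
  obtain _ | m := m
  · simp [energy]
  · simpa [energy, abs_mul] using mul_le_one₀ hp (abs_nonneg _) (hg i)

/-- The sum of the energies of consecutive paths. -/
def blockEnergy (g : ℕ → ℤ) : List ℕ → ℕ → ℤ
  | [], _ => 0
  | m :: ms, i => energy g m 0 i + blockEnergy g ms (i + m)

theorem abs_energy_sub_blockEnergy_le {g : ℕ → ℤ} (hg : ∀ j, |g j| ≤ 1) :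
    ∀ (ms : List ℕ) {p : ℤ} (i : ℕ), |p| ≤ 1 →
      |energy g ms.sum p i - blockEnergy g ms i| ≤ ms.length
  | [], _, _, _ => by simp [energy, blockEnergy]
  | m :: ms, p, i, hp => by
    obtain ⟨q, hq, h⟩ := exists_energy_add hg m ms.sum i hp
    have h1 := abs_energy_sub_le hg m i hp
    have h2 := abs_energy_sub_blockEnergy_le hg ms (i + m) hq
    rw [List.sum_cons, h, blockEnergy, List.length_cons]
    rw [abs_le] at *
    push_cast
    constructor <;> linarith

theorem abs_energy_sub_blockEnergy_lt {g : ℕ → ℤ} (hg : ∀ j, |g j| ≤ 1) {ms : List ℕ}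
    (hms : ms ≠ []) (i : ℕ) :
    |energy g ms.sum 0 i - blockEnergy g ms i| < ms.length := by
  obtain ⟨m, ms, rfl⟩ := List.exists_cons_of_ne_nil hms
  obtain ⟨q, hq, h⟩ := exists_energy_add hg m ms.sum (p := 0) i (by simp)
  have h2 := abs_energy_sub_blockEnergy_le hg ms (i + m) hq
  rw [List.sum_cons, h, blockEnergy, List.length_cons, add_sub_add_left_eq_sub]
  push_cast
  linarith

theorem blockSegs_of_ne_zero {f : ℕ → ℕ} (hf : ∀ j, IsSide (f j)) :
    ∀ {ms : List ℕ} {i : ℕ}, (∀ j, i ≤ j → j < i + ms.sum → f j ≠ 0) →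
      (∀ c ∈ blockSegs f ms i, c < 8) ∧
        (((blockSegs f ms i).map segWeight).sum : ℤ) =
          ms.sum + ms.length - blockEnergy (fun j => sign (f j)) ms i
  | [], _, _ => by simp [blockSegs, blockEnergy]
  | m :: ms, i, h => by
    rw [List.sum_cons] at h
    obtain ⟨h1, h2⟩ := segs_of_ne_zero hf (m := m) (i := i) (.inl rfl) fun j h1 h2 =>
      h j h1 (by omega)
    obtain ⟨h3, h4⟩ := blockSegs_of_ne_zero hf (ms := ms) (i := i + m) fun j h1 h2 =>
      h j (by omega) (by omega)
    refine ⟨fun c hc => ?_, ?_⟩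
    · obtain hc | hc := Multiset.mem_add.1 hc
      exacts [h1 c hc, h3 c hc]
    · rw [blockSegs, Multiset.map_add, Multiset.sum_add, Nat.cast_add, h2, h4, blockEnergy,
        List.sum_cons, List.length_cons, show sign 0 = 0 from rfl]
      push_cast
      ring

theorem cordVal_succ {V : Type*} [Fintype V] [inst : DecidableEq V] (G : SimpleGraph V) (k : ℕ)
    (t : Bool) (S0 S1 : Finset V) :
    cordVal G (k + 1) t S0 S1 =
      if h : (Finset.univ \ (S0 ∪ S1)).Nonempty then
        if t then (Finset.univ \ (S0 ∪ S1)).inf' h fun v => cordVal G k false (insert v S0) S1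
        else (Finset.univ \ (S0 ∪ S1)).sup' h fun v => cordVal G k true S0 (insert v S1)
      else |bscore G ↑S0 ↑S1| := by
  obtain rfl : inst = Classical.decEq V := Subsingleton.elim _ _
  rfl

/-- `Forces P t X Y`: with `X` selected by the opponent and `Y` by the responder, the responder
can force the final sets to satisfy `P`.  The responder is to move if `t = true`. -/
inductive Forces {V : Type*} [DecidableEq V] (P : Finset V → Finset V → Prop) :
    Bool → Finset V → Finset V → Prop
  | done {t : Bool} {X Y : Finset V} : (∀ v, v ∈ X ∨ v ∈ Y) → P X Y → Forces P t X Y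
  | reply {X Y : Finset V} (v : V) : v ∉ X → v ∉ Y → Forces P false X (insert v Y) →
      Forces P true X Y
  | await {X Y : Finset V} (v : V) : v ∉ X → v ∉ Y →
      (∀ v, v ∉ X → v ∉ Y → Forces P true (insert v X) Y) → Forces P false X Y

section

variable {V : Type*} [Fintype V] [DecidableEq V]

/-- The number of unselected vertices. -/
def numFree (X Y : Finset V) : ℕ := (Finset.univ \ (X ∪ Y)).card

theorem numFree_insert_left {X Y : Finset V} {v : V} (hX : v ∉ X) (hY : v ∉ Y) :
    numFree (insert v X) Y < numFree X Y := by
  refine Finset.card_lt_card ((Finset.ssubset_iff_of_subset fun w hw => ?_).2 ⟨v, ?_, ?_⟩)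
  · simp only [Finset.mem_sdiff, Finset.mem_union, Finset.mem_insert] at hw ⊢
    tauto
  · simp [hX, hY]
  · simp

theorem numFree_comm (X Y : Finset V) : numFree X Y = numFree Y X := by
  rw [numFree, numFree, Finset.union_comm]

theorem numFree_insert_right {X Y : Finset V} {v : V} (hX : v ∉ X) (hY : v ∉ Y) :
    numFree X (insert v Y) < numFree X Y := by
  rw [numFree_comm, numFree_comm X]
  exact numFree_insert_left hY hX

theorem numFree_pos {X Y : Finset V} {v : V} (hX : v ∉ X) (hY : v ∉ Y) : 0 < numFree X Y :=
  Nat.zero_lt_of_lt (numFree_insert_left hX hY)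

theorem not_nonempty_of_forall {X Y : Finset V} (h : ∀ v, v ∈ X ∨ v ∈ Y) :
    ¬(Finset.univ \ (X ∪ Y)).Nonempty := by
  rintro ⟨v, hv⟩
  simp only [Finset.mem_sdiff, Finset.mem_union] at hv
  exact hv.2 (h v)

theorem cordVal_of_forall {G : SimpleGraph V} {k : ℕ} {t : Bool} {X Y : Finset V}
    (h : ∀ v, v ∈ X ∨ v ∈ Y) : cordVal G k t X Y = |bscore G ↑X ↑Y| := by
  obtain _ | k := k
  · rfl
  · rw [cordVal_succ, dif_neg (not_nonempty_of_forall h)]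

theorem Forces.cordVal_le {G : SimpleGraph V} {B : ℤ} {t : Bool} {X Y : Finset V}
    (h : Forces (fun X Y => |bscore G ↑Y ↑X| ≤ B) t X Y) :
    ∀ k, numFree X Y ≤ k → cordVal G k t Y X ≤ B := by
  induction h with
  | done h hP =>
    intro k _
    rwa [cordVal_of_forall fun v => (h v).symm]
  | @reply X Y v hX hY _ ih =>
    intro k hk
    have h1 := numFree_insert_right hX hY
    obtain _ | k := k
    · omega
    have hv : v ∈ Finset.univ \ (Y ∪ X) := by simp [hX, hY]
    rw [cordVal_succ, dif_pos ⟨v, hv⟩, if_pos rfl]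
    exact (Finset.inf'_le _ hv).trans (ih k (by omega))
  | @await X Y v hX hY _ ih =>
    intro k hk
    have h1 := numFree_pos hX hY
    obtain _ | k := k
    · omega
    have hv : v ∈ Finset.univ \ (Y ∪ X) := by simp [hX, hY]
    rw [cordVal_succ, dif_pos ⟨v, hv⟩, if_neg Bool.false_ne_true]
    refine Finset.sup'_le _ _ fun w hw => ?_
    simp only [Finset.mem_sdiff, Finset.mem_union, not_or] at hw
    have h2 := numFree_insert_left hw.2.2 hw.2.1
    exact ih w hw.2.2 hw.2.1 k (by omega)

theorem Forces.le_cordVal {G : SimpleGraph V} {B : ℤ} {t : Bool} {X Y : Finset V}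
    (h : Forces (fun X Y => B ≤ |bscore G ↑X ↑Y|) t X Y) :
    ∀ k, numFree X Y ≤ k → B ≤ cordVal G k (!t) X Y := by
  induction h with
  | done h hP =>
    intro k _
    rwa [cordVal_of_forall h]
  | @reply X Y v hX hY _ ih =>
    intro k hk
    have h1 := numFree_insert_right hX hY
    obtain _ | k := k
    · omega
    have hv : v ∈ Finset.univ \ (X ∪ Y) := by simp [hX, hY]
    rw [cordVal_succ, dif_pos ⟨v, hv⟩, if_neg (by simp)]
    exact (ih k (by omega)).trans (Finset.le_sup' (fun v => cordVal G k true X (insert v Y)) hv)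
  | @await X Y v hX hY _ ih =>
    intro k hk
    have h1 := numFree_pos hX hY
    obtain _ | k := k
    · omega
    have hv : v ∈ Finset.univ \ (X ∪ Y) := by simp [hX, hY]
    rw [cordVal_succ, dif_pos ⟨v, hv⟩, if_pos (by simp)]
    refine Finset.le_inf' _ _ fun w hw => ?_
    simp only [Finset.mem_sdiff, Finset.mem_union, not_or] at hw
    have h2 := numFree_insert_left hw.2.1 hw.2.2
    exact ih w hw.2.1 hw.2.2 k (by omega)

/-- Every position in `W` has a reply inside `U` to every opponent move inside `U`, and
remains in `W` when vertices outside of `U` are selected. -/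
structure IsResponseSystem (U : Set V) (W P : Finset V → Finset V → Prop) : Prop where
  exists_reply : ∀ {X Y v}, W X Y → v ∈ U → v ∉ X → v ∉ Y →
    ∃ u ∈ U, u ≠ v ∧ u ∉ X ∧ u ∉ Y ∧ W (insert v X) (insert u Y)
  insert_left : ∀ {X Y v}, W X Y → v ∉ U → v ∉ X → v ∉ Y → W (insert v X) Y
  insert_right : ∀ {X Y v}, W X Y → v ∉ U → v ∉ X → v ∉ Y → W X (insert v Y)
  final : ∀ {X Y}, W X Y → (∀ v, v ∈ X ∨ v ∈ Y) → P X Y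

theorem IsResponseSystem.forces_aux {U : Set V} {W P : Finset V → Finset V → Prop}
    (h : IsResponseSystem U W P) : ∀ n : ℕ, ∀ X Y, numFree X Y ≤ n → W X Y →
      Forces P false X Y ∧ Forces P true X Y ∧
        ∀ w ∈ U, w ∉ X → w ∉ Y → (∀ v, v ∉ X → v ∉ Y → v ∈ U) →
          Forces P false X (insert w Y) := by
  intro n
  induction n using Nat.strong_induction_on with
  | _ n IH =>
  intro X Y hn hW
  have h3 : ∀ w ∈ U, w ∉ X → w ∉ Y → (∀ v, v ∉ X → v ∉ Y → v ∈ U) →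
      Forces P false X (insert w Y) := by
    intro w hw hwX hwY hU
    obtain ⟨u, hu, huw, huX, huY, -⟩ := h.exists_reply hW hw hwX hwY
    refine .await u huX (by simp [huw, huY]) fun v hvX hv => ?_
    obtain ⟨hvw, hvY⟩ : v ≠ w ∧ v ∉ Y := by simpa using hv
    obtain ⟨u, hu, huv, huX, huY, hW'⟩ := h.exists_reply hW (hU v hvX hvY) hvX hvY
    have hlt : numFree (insert v X) (insert u Y) < numFree X Y :=
      (numFree_insert_right (by simp [huv, huX]) huY).trans (numFree_insert_left hvX hvY)
    obtain ⟨-, h2, h3⟩ := IH _ (hlt.trans_le hn) _ _ le_rfl hW'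
    obtain rfl | hne := eq_or_ne u w
    · exact h2
    · refine .reply u (by simp [huv, huX]) (by simp [hne, huY]) ?_
      rw [Finset.insert_comm]
      refine h3 w hw (by simp [hvw.symm, hwX]) (by simp [hne.symm, hwY]) fun x hx hx' => ?_
      simp only [Finset.mem_insert, not_or] at hx hx'
      exact hU x hx.2 hx'.2
  have h2 : Forces P true X Y := by
    by_cases hf : ∀ v, v ∈ X ∨ v ∈ Y
    · exact .done hf (h.final hW hf)
    push Not at hf
    by_cases hd : ∃ v, v ∉ U ∧ v ∉ X ∧ v ∉ Y
    · obtain ⟨v, hv, hX, hY⟩ := hd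
      exact .reply v hX hY (IH _ ((numFree_insert_right hX hY).trans_le hn) _ _ le_rfl
        (h.insert_right hW hv hX hY)).1
    · obtain ⟨w, hX, hY⟩ := hf
      have hU : ∀ v, v ∉ X → v ∉ Y → v ∈ U := fun v h1 h2 =>
        by_contra fun h3 => hd ⟨v, h3, h1, h2⟩
      exact .reply w hX hY (h3 w (hU w hX hY) hX hY hU)
  refine ⟨?_, h2, h3⟩
  by_cases hf : ∀ v, v ∈ X ∨ v ∈ Y
  · exact .done hf (h.final hW hf)
  push Not at hf
  obtain ⟨w, hwX, hwY⟩ := hf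
  refine .await w hwX hwY fun v hX hY => ?_
  have hlt := numFree_insert_left hX hY
  by_cases hv : v ∈ U
  · obtain ⟨u, hu, huv, huX, huY, hW'⟩ := h.exists_reply hW hv hX hY
    have huX' : u ∉ insert v X := by simp [huv, huX]
    exact .reply u huX' huY
      (IH _ (((numFree_insert_right huX' huY).trans hlt).trans_le hn) _ _ le_rfl hW').1
  · exact (IH _ (hlt.trans_le hn) _ _ le_rfl (h.insert_left hW hv hX hY)).2.1

theorem IsResponseSystem.forces {U : Set V} {W P : Finset V → Finset V → Prop}
    (h : IsResponseSystem U W P) (hW : W ∅ ∅) (t : Bool) : Forces P t ∅ ∅ := by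
  obtain ⟨h1, h2, -⟩ := h.forces_aux _ _ _ le_rfl hW
  cases t
  exacts [h1, h2]

theorem cordA_le_of_forces {G : SimpleGraph V} {B : ℤ}
    (h : Forces (fun X Y : Finset V => |bscore G ↑Y ↑X| ≤ B) true ∅ ∅) : cordA G ≤ B :=
  h.cordVal_le _ (Finset.card_le_univ _)

theorem cordI_le_of_forces {G : SimpleGraph V} {B : ℤ}
    (h : Forces (fun X Y : Finset V => |bscore G ↑Y ↑X| ≤ B) false ∅ ∅) : cordI G ≤ B :=
  h.cordVal_le _ (Finset.card_le_univ _)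

theorem le_cordA_of_forces {G : SimpleGraph V} {B : ℤ}
    (h : Forces (fun X Y : Finset V => B ≤ |bscore G ↑X ↑Y|) false ∅ ∅) : B ≤ cordA G :=
  h.le_cordVal _ (Finset.card_le_univ _)

theorem le_cordI_of_forces {G : SimpleGraph V} {B : ℤ}
    (h : Forces (fun X Y : Finset V => B ≤ |bscore G ↑X ↑Y|) true ∅ ∅) : B ≤ cordI G :=
  h.le_cordVal _ (Finset.card_le_univ _)

end

theorem ncard_pathGraph_edges (m : ℕ) (p : Sym2 (Fin (m + 1)) → Prop) [DecidablePred p] :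
    {e ∈ (SimpleGraph.pathGraph (m + 1)).edgeSet | p e}.ncard =
      (Finset.univ.filter fun i : Fin m => p s(i.castSucc, i.succ)).card := by
  have hinj : Function.Injective fun i : Fin m => s(i.castSucc, i.succ) := by
    intro i j h
    simp only [Sym2.eq_iff, Fin.ext_iff, Fin.val_castSucc, Fin.val_succ] at h
    ext
    omega
  rw [← Set.ncard_coe_finset, ← Set.ncard_image_of_injective _ hinj]
  congr 1
  ext e
  induction e with | _ u v
  simp only [Set.mem_ofPred_eq, SimpleGraph.mem_edgeSet, SimpleGraph.pathGraph_adj, Set.mem_image,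
    Finset.coe_filter, Finset.mem_univ, true_and]
  constructor
  · rintro ⟨h | h, hp⟩
    · refine ⟨⟨u, by omega⟩, ?_⟩
      have : s(Fin.castSucc ⟨u.val, by omega⟩, Fin.succ (⟨u.val, by omega⟩ : Fin m)) = s(u, v) := by
        simp [h]
      exact ⟨this ▸ hp, this⟩
    · refine ⟨⟨v, by omega⟩, ?_⟩
      have : s(Fin.castSucc ⟨v.val, by omega⟩, Fin.succ (⟨v.val, by omega⟩ : Fin m)) = s(u, v) := by
        simp [Fin.ext_iff, h]
      exact ⟨this ▸ hp, this⟩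
  · rintro ⟨i, hp, hi⟩
    refine ⟨?_, hi ▸ hp⟩
    simp only [Sym2.eq_iff, Fin.ext_iff, Fin.val_castSucc, Fin.val_succ] at hi
    omega

theorem energy_eq_sum {g : ℕ → ℤ} :
    ∀ (m : ℕ) (p : ℤ) (i : ℕ),
      energy g (m + 1) p i = p * g i + ∑ j : Fin m, g (i + j) * g (i + j + 1)
  | 0, p, i => by simp [energy]
  | m + 1, p, i => by
    rw [energy, energy_eq_sum m, Fin.sum_univ_succ]
    simp only [Fin.val_zero, add_zero, Fin.val_succ, add_right_comm i 1, add_assoc]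

theorem bscore_comm {V : Type*} (G : SimpleGraph V) (S T : Set V) :
    bscore G S T = bscore G T S := by
  unfold bscore
  congr 3
  · ext e
    refine and_congr_right fun _ => ⟨?_, ?_⟩ <;>
    · rintro ⟨u, hu, v, hv, rfl⟩
      exact ⟨v, hv, u, hu, Sym2.eq_swap⟩
  · ext e
    exact and_congr_right fun _ => or_comm

theorem bscore_pathGraph {n : ℕ} {g : ℕ → ℤ} {S T : Set (Fin n)} (hS : ∀ v ∈ S, g v = 1)
    (hT : ∀ v ∈ T, g v = -1) (h : ∀ v, v ∈ S ∨ v ∈ T) :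
    bscore (SimpleGraph.pathGraph n) S T = -energy g n 0 0 := by
  classical
  obtain _ | m := n
  · simp [bscore, energy, Set.eq_empty_of_isEmpty]
  have hS' : ∀ v, v ∈ S ↔ g v = 1 := fun v =>
    ⟨hS v, fun hv => (h v).resolve_right fun hv' => by have := hT v hv'; omega⟩
  have hT' : ∀ v, v ∈ T ↔ g v = -1 := fun v =>
    ⟨hT v, fun hv => (h v).resolve_left fun hv' => by have := hS v hv'; omega⟩
  rw [bscore, ncard_pathGraph_edges, ncard_pathGraph_edges, Finset.card_filter,
    Finset.card_filter, energy_eq_sum]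
  push_cast
  rw [← Finset.sum_sub_distrib, zero_mul, zero_add, ← Finset.sum_neg_distrib]
  refine Finset.sum_congr rfl fun i _ => ?_
  have e1 : (∃ u ∈ S, ∃ v ∈ T, s(i.castSucc, i.succ) = s(u, v)) ↔
      (g i = 1 ∧ g (i + 1) = -1) ∨ (g i = -1 ∧ g (i + 1) = 1) := by
    simp only [Sym2.eq_iff, hS', hT']
    constructor
    · rintro ⟨u, hu, v, hv, ⟨rfl, rfl⟩ | ⟨rfl, rfl⟩⟩
      · exact .inl ⟨by simpa using hu, by simpa using hv⟩
      · exact .inr ⟨by simpa using hv, by simpa using hu⟩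
    · rintro (⟨h1, h2⟩ | ⟨h1, h2⟩)
      · exact ⟨_, by simpa using h1, _, by simpa using h2, .inl ⟨rfl, rfl⟩⟩
      · exact ⟨_, by simpa using h2, _, by simpa using h1, .inr ⟨rfl, rfl⟩⟩
  have e2 : ∀ (A : Set (Fin (m + 1))) (c : ℤ), (∀ v, v ∈ A ↔ g v = c) →
      ((∃ u ∈ A, ∃ v ∈ A, s(i.castSucc, i.succ) = s(u, v)) ↔ (g i = c ∧ g (i + 1) = c)) := by
    intro A c hA
    simp only [Sym2.eq_iff, hA]
    constructor
    · rintro ⟨u, hu, v, hv, ⟨rfl, rfl⟩ | ⟨rfl, rfl⟩⟩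
      · exact ⟨by simpa using hu, by simpa using hv⟩
      · exact ⟨by simpa using hv, by simpa using hu⟩
    · rintro ⟨h1, h2⟩
      exact ⟨_, by simpa using h1, _, by simpa using h2, .inl ⟨rfl, rfl⟩⟩
  rw [if_congr e1 rfl rfl, if_congr (or_congr (e2 S 1 hS') (e2 T (-1) hT')) rfl rfl, zero_add]
  have a1 : g i = 1 ∨ g i = -1 := by simpa [hS', hT'] using h i.castSucc
  have a2 : g (i + 1) = 1 ∨ g (i + 1) = -1 := by simpa [hS', hT'] using h i.succ
  obtain a1 | a1 := a1 <;> obtain a2 | a2 := a2 <;> simp [a1, a2]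

/-- The colouring of the path by the sets `X` of the opponent and `Y` of the responder. -/
def colour {n : ℕ} (X Y : Finset (Fin n)) (i : ℕ) : ℕ :=
  if ∃ v ∈ X, v.val = i then 3 else if ∃ v ∈ Y, v.val = i then 1 else 0

section

variable {n : ℕ} {X Y : Finset (Fin n)}

theorem isSide_colour (i : ℕ) : IsSide (colour X Y i) := by
  unfold colour IsSide
  split_ifs <;> simp

theorem colour_insert_left (v : Fin n) :
    colour (insert v X) Y = Function.update (colour X Y) v 3 := by
  ext i
  obtain rfl | h := eq_or_ne i v
  · simp [colour]
  · simp [colour, h, h.symm]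

theorem colour_insert_right {v : Fin n} (hv : v ∉ X) :
    colour X (insert v Y) = Function.update (colour X Y) v 1 := by
  ext i
  obtain rfl | h := eq_or_ne i v
  · simp [colour, Fin.val_inj, hv]
  · simp [colour, h, h.symm]

theorem colour_eq_zero {v : Fin n} : colour X Y v = 0 ↔ v ∉ X ∧ v ∉ Y := by
  simp only [colour, Fin.val_inj, exists_eq_right]
  split_ifs <;> simp_all

/-- The positions from which the responder answers according to the table, where the vertices
of the path are cut into consecutive blocks `ms`. -/
def PathState (ms : List ℕ) (lo hi : ℕ) (X Y : Finset (Fin n)) : Prop :=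
  Disjoint X Y ∧
    ∃ a b, Good responseTable (blockSegs (colour X Y) ms 0) a b ∧ lo ≤ a ∧ b ≤ hi

theorem PathState.bounds {ms : List ℕ} {lo hi : ℕ} (hn : ms.sum ≤ n) (hn' : n ≤ ms.sum + 1)
    (h : PathState ms lo hi X Y) (hf : ∀ v, v ∈ X ∨ v ∈ Y) :
    (lo : ℤ) - ms.length - (ms.length - 1 : ℕ) - n ≤ bscore (SimpleGraph.pathGraph n) ↑Y ↑X ∧
      bscore (SimpleGraph.pathGraph n) ↑Y ↑X ≤
        hi - ms.length + (ms.length - 1 : ℕ) + n - 2 * ms.sum := by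
  obtain ⟨hXY, a, b, hg, ha, hb⟩ := h
  set g : ℕ → ℤ := fun j => sign (colour X Y j) with hg'
  have habs : ∀ j, |g j| ≤ 1 := fun j => abs_sign_le _
  have hX : ∀ v ∈ X, colour X Y v = 3 := fun v hv => by simp [colour, Fin.val_inj, hv]
  have hY : ∀ v ∈ Y, colour X Y v = 1 := fun v hv => by
    simp [colour, Fin.val_inj, hv, Finset.disjoint_right.1 hXY hv]
  have hne : ∀ j, 0 ≤ j → j < 0 + ms.sum → colour X Y j ≠ 0 := fun j _ hj h0 => by
    have := (colour_eq_zero (v := ⟨j, by omega⟩)).1 h0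
    exact (hf _).elim this.1 this.2
  obtain ⟨h8, hw⟩ := blockSegs_of_ne_zero isSide_colour hne
  obtain ⟨h1, h2⟩ := hg.bounds responseTable_all h8
  have hE : |energy g ms.sum 0 0 - blockEnergy g ms 0| ≤ (ms.length - 1 : ℕ) := by
    obtain rfl | hms := eq_or_ne ms []
    · simp [energy, blockEnergy]
    · have := abs_energy_sub_blockEnergy_lt habs hms 0
      have := List.length_pos_iff.2 hms
      omega
  obtain ⟨q, hq, hsplit⟩ := exists_energy_add habs ms.sum (n - ms.sum) (p := 0) 0 (by simp)
  rw [Nat.add_sub_cancel' hn] at hsplit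
  have hlast : |energy g (n - ms.sum) q (0 + ms.sum)| ≤ (n - ms.sum : ℕ) := by
    obtain h | h : n - ms.sum = 0 ∨ n - ms.sum = 1 := by omega
    · simp [h, energy]
    · simpa [h, energy, abs_mul] using mul_le_one₀ hq (abs_nonneg _) (habs ms.sum)
  have hb := bscore_pathGraph (g := g) (S := ↑Y) (T := ↑X)
    (fun v hv => by simp [hg', hY v hv, sign]) (fun v hv => by simp [hg', hX v hv, sign])
    fun v => (hf v).symm
  rw [hb, hsplit]
  rw [abs_le] at hE hlast
  zify [hn] at *
  constructor <;> linarith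

theorem PathState.isResponseSystem {ms : List ℕ} {lo hi : ℕ} (hn : ms.sum ≤ n)
    {P : Finset (Fin n) → Finset (Fin n) → Prop}
    (hP : ∀ X Y, PathState ms lo hi X Y → (∀ v, v ∈ X ∨ v ∈ Y) → P X Y) :
    IsResponseSystem {v : Fin n | v.val < ms.sum} (PathState ms lo hi) P where
  exists_reply {X Y v} := by
    rintro ⟨hXY, a, b, hg, ha, hb⟩ hv hX hY
    have hm := segMove_blockSegs_update isSide_colour (σ := 3) (by norm_num)
      (colour_eq_zero.2 ⟨hX, hY⟩) (Nat.zero_le _) (by simpa using hv)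
    rw [← colour_insert_left] at hm
    obtain ⟨N, a', b', hr, hg', ha', hb'⟩ := hg.exists_reply responseTable_all hm
    obtain ⟨j, -, hj, hj0, rfl⟩ := eq_blockSegs_of_segMove isSide_colour one_ne_zero hr
    obtain ⟨u, rfl⟩ : ∃ u : Fin n, u.val = j := ⟨⟨j, by omega⟩, rfl⟩
    obtain ⟨huX, huY⟩ := colour_eq_zero.1 hj0
    rw [← colour_insert_right huX] at hg'
    simp only [Finset.mem_insert, not_or] at huX
    refine ⟨u, by simpa using hj, huX.1, huX.2, huY, ?_, a', b', hg', by omega, by omega⟩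
    simp [hXY, huX, hY]
  insert_left {X Y v} := by
    rintro ⟨hXY, a, b, hg, ha, hb⟩ hv hX hY
    refine ⟨by simp [hXY, hY], a, b, ?_, ha, hb⟩
    simp only [Set.mem_ofPred_eq] at hv
    rwa [colour_insert_left, blockSegs_congr fun j _ hj => Function.update_of_ne (by omega) _ _]
  insert_right {X Y v} := by
    rintro ⟨hXY, a, b, hg, ha, hb⟩ hv hX hY
    refine ⟨by simp [hXY, hX], a, b, ?_, ha, hb⟩
    simp only [Set.mem_ofPred_eq] at hv
    rwa [colour_insert_right hX,
      blockSegs_congr fun j _ hj => Function.update_of_ne (by omega) _ _]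
  final {X Y} := hP X Y

theorem segs_of_eq_zero {f : ℕ → ℕ} (hf : ∀ j, f j = 0) :
    ∀ {m k i : ℕ}, segs f m 0 k i = {8 * (k + m)}
  | 0, k, i => by simp [segs]
  | m + 1, k, i => by
    rw [segs, if_pos (hf i), segs_of_eq_zero hf]
    congr 2
    omega

theorem exists_good_blockSegs {f : ℕ → ℕ} (hf : ∀ j, f j = 0) {lo hi : ℕ → ℕ} :
    ∀ {ms : List ℕ} {i : ℕ},
      (∀ m ∈ ms, ∃ a b, Good responseTable {8 * m} a b ∧ lo m ≤ a ∧ b ≤ hi m) →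
      ∃ a b, Good responseTable (blockSegs f ms i) a b ∧
        (ms.map lo).sum ≤ a ∧ b ≤ (ms.map hi).sum
  | [], _, _ => ⟨0, 0, .zero, by simp⟩
  | m :: ms, i, h => by
    obtain ⟨a, b, hg, ha, hb⟩ := h m (by simp)
    obtain ⟨a', b', hg', ha', hb'⟩ :=
      exists_good_blockSegs hf (i := i + m) fun m' hm' => h m' (List.mem_cons_of_mem _ hm')
    refine ⟨a + a', b + b', ?_, ?_, ?_⟩
    · rw [blockSegs, segs_of_eq_zero hf, zero_add]
      exact hg.add hg'
    all_goals
      rw [List.map_cons, List.sum_cons]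
      omega

theorem PathState.empty {ms : List ℕ} {lo hi : ℕ → ℕ}
    (h : ∀ m ∈ ms, ∃ a b, Good responseTable {8 * m} a b ∧ lo m ≤ a ∧ b ≤ hi m) :
    PathState ms (ms.map lo).sum (ms.map hi).sum (∅ : Finset (Fin n)) ∅ :=
  ⟨disjoint_bot_left, exists_good_blockSegs (fun j => by simp [colour]) h⟩

end

theorem forces_abs_bscore_le {n : ℕ} (hn : 1 ≤ n) (t : Bool) :
    Forces (fun X Y : Finset (Fin n) => |bscore (SimpleGraph.pathGraph n) ↑Y ↑X| ≤
      4 * ((n + 15) / 16 : ℕ) - if Even n then 1 else 0) t ∅ ∅ := by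
  obtain ⟨r, hr⟩ : ∃ r, r = if n / 2 * 2 % 16 = 0 then [] else [n / 2 * 2 % 16] := ⟨_, rfl⟩
  obtain ⟨ms, hms⟩ : ∃ ms, ms = List.replicate (n / 2 * 2 / 16) 16 ++ r := ⟨_, rfl⟩
  have hgood : ∀ m ∈ ms, ∃ a b, Good responseTable {8 * m} a b ∧ m - 2 ≤ a ∧ b ≤ m + 4 := by
    intro m hm
    rw [hms, hr, List.mem_append, List.mem_replicate] at hm
    obtain ⟨-, rfl⟩ | hm := hm
    · exact exists_good_even (by norm_num) le_rfl (by decide)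
    · split_ifs at hm with h0
      · simp at hm
      · rw [List.mem_singleton] at hm
        exact exists_good_even (by omega) (by omega) (Nat.even_iff.2 (by omega))
  have hsum : ms.sum = n / 2 * 2 := by
    simp only [hms, hr, List.sum_append, List.sum_replicate, smul_eq_mul]
    split_ifs <;> simp <;> omega
  have hlen : ms.length = (n / 2 * 2 + 15) / 16 := by
    simp only [hms, hr, List.length_append, List.length_replicate]
    split_ifs <;> simp <;> omega
  have hlo : (ms.map fun m => m - 2).sum + 2 * ms.length = ms.sum := by
    simp only [hms, hr, List.map_append, List.map_replicate, List.length_append,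
      List.length_replicate, List.sum_append, List.sum_replicate, smul_eq_mul]
    split_ifs <;> simp <;> omega
  have hhi : (ms.map fun m => m + 4).sum = ms.sum + 4 * ms.length := by
    simp [List.sum_map_add, mul_comm]
  refine (PathState.isResponseSystem (by omega) fun X Y hW hf => ?_).forces
    (PathState.empty hgood) t
  obtain ⟨h1, h2⟩ := hW.bounds (by omega) (by omega) hf
  rw [abs_le]
  split_ifs with he
  · rw [Nat.even_iff] at he
    omega
  · rw [Nat.even_iff] at he
    omega

theorem forces_le_abs_bscore {n : ℕ} (hn : 1 ≤ n) (t : Bool) :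
    Forces (fun X Y : Finset (Fin n) => 2 * ((n / 16 : ℕ) : ℤ) + (if Even n then 1 else 0) ≤
      |bscore (SimpleGraph.pathGraph n) ↑X ↑Y|) t ∅ ∅ := by
  obtain ⟨ms, hms⟩ : ∃ ms, ms =
    List.replicate (n / 16) 16 ++ List.replicate (n % 16 / 2) 2 := ⟨_, rfl⟩
  have hgood : ∀ m ∈ ms, ∃ a b, Good responseTable {8 * m} a b ∧
      m + (if m = 16 then 4 else 2) ≤ a ∧ b ≤ 2 * m := by
    intro m hm
    rw [hms, List.mem_append, List.mem_replicate, List.mem_replicate] at hm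
    obtain ⟨-, rfl⟩ | ⟨-, rfl⟩ := hm
    exacts [exists_good_sixteen, exists_good_two]
  have hsum : ms.sum = n / 2 * 2 := by
    simp [hms]
    omega
  have hlen : ms.length = n / 16 + n % 16 / 2 := by simp [hms]
  have hlo : (ms.map fun m => m + if m = 16 then 4 else 2).sum =
      20 * (n / 16) + 4 * (n % 16 / 2) := by
    simp [hms, mul_comm]
  refine (PathState.isResponseSystem (by omega) fun X Y hW hf => ?_).forces
    (PathState.empty hgood) t
  obtain ⟨h1, -⟩ := hW.bounds (by omega) (by omega) hf
  rw [hlo, hlen] at h1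
  rw [bscore_comm]
  obtain rfl | hn1 := hn.eq_or_lt
  · simp
  refine le_trans ?_ (le_abs_self _)
  split_ifs with he
  · rw [Nat.even_iff] at he
    omega
  · rw [Nat.even_iff] at he
    omega

theorem statement_19 (n : ℕ) (hn : 1 ≤ n) :
    (Even n →
      (2 * ((n / 16 : ℕ) : ℤ) + 1 ≤ cordA (SimpleGraph.pathGraph n) ∧
        cordA (SimpleGraph.pathGraph n) ≤ 4 * (((n + 15) / 16 : ℕ) : ℤ) + 5) ∧
      (2 * ((n / 16 : ℕ) : ℤ) - 5 ≤ cordI (SimpleGraph.pathGraph n) ∧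
        cordI (SimpleGraph.pathGraph n) ≤ 4 * (((n + 15) / 16 : ℕ) : ℤ) - 1)) ∧
    (Odd n →
      (2 * ((n / 16 : ℕ) : ℤ) - 4 ≤ cordA (SimpleGraph.pathGraph n) ∧
        cordA (SimpleGraph.pathGraph n) ≤ 4 * (((n + 15) / 16 : ℕ) : ℤ)) ∧
      (2 * ((n / 16 : ℕ) : ℤ) ≤ cordI (SimpleGraph.pathGraph n) ∧
        cordI (SimpleGraph.pathGraph n) ≤ 4 * (((n + 15) / 16 : ℕ) : ℤ) + 4)) := by
  constructor <;> intro h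
  · have hu := forces_abs_bscore_le hn
    have hl := forces_le_abs_bscore hn
    simp only [h, if_true] at hu hl
    have h1 := cordA_le_of_forces (hu true)
    have h2 := cordI_le_of_forces (hu false)
    have h3 := le_cordA_of_forces (hl false)
    have h4 := le_cordI_of_forces (hl true)
    omega
  · have hu := forces_abs_bscore_le hn
    have hl := forces_le_abs_bscore hn
    simp only [Nat.not_even_iff_odd.2 h, if_false] at hu hl
    have h1 := cordA_le_of_forces (hu true)
    have h2 := cordI_le_of_forces (hu false)
    have h3 := le_cordA_of_forces (hl false)
    have h4 := le_cordI_of_forces (hl true)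
    omega
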